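/- arXiv:1410.2484 — 12 statements merged into one kernel-verified Lean document; each statement's English description precedes it below -/
import Mathlib

section
/- Let (X,d) be a metric space, f : X → ℝ ∪ {±∞}, and x̄ a point with f(x̄) finite. Then x̄ is a local sharp minimizer of f if and only if x̄ is superstable, i.e. there exists ε₀ > 0 such that x̄ is a local minimizer of f + g for every function g : X → ℝ ∪ {±∞} with g(x̄) finite and strong slope |∇g|(x̄) < ε₀. -/
open Filter Metric Set Topology
open scoped ENNReal RealInnerProductSpace

noncomputable section

/-- The steepest descent rate `f↓(xb) = liminf_{x→xb, x≠xb} (f x − f xb)/d(x,xb)`. -/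
def descentRate {X : Type*} [MetricSpace X] (f : X → EReal) (xb : X) : EReal :=
  Filter.liminf (fun x => (f x - f xb) * (((dist x xb)⁻¹ : ℝ) : EReal)) (𝓝[≠] xb)

open Classical in
/-- The strong slope `|∇g|(xb)`: `0` if `xb` is a local minimizer of `g`, and
`limsup_{x→xb, x≠xb} (g xb − g x)/d(x,xb)` otherwise. -/
def strongSlope {X : Type*} [MetricSpace X] (g : X → EReal) (xb : X) : EReal :=
  if ∀ᶠ x in 𝓝 xb, g xb ≤ g x then 0
  else Filter.limsup (fun x => (g xb - g x) * (((dist x xb)⁻¹ : ℝ) : EReal)) (𝓝[≠] xb)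

/-- `xb` is a local sharp minimizer of `f`. -/
def IsLocalSharpMin {X : Type*} [MetricSpace X] (f : X → EReal) (xb : X) : Prop :=
  ∃ σ : ℝ, 0 < σ ∧ ∃ r : ℝ, 0 < r ∧
    ∀ x ∈ closedBall xb r, f xb + ((σ * dist x xb : ℝ) : EReal) ≤ f x

/-- The modulus of local sharpness `shar(f,xb)`. -/
def sharpnessModulus {X : Type*} [MetricSpace X] (f : X → EReal) (xb : X) : EReal :=
  sSup {y : EReal | ∃ σ : ℝ, 0 < σ ∧
    (∃ r : ℝ, 0 < r ∧ ∀ x ∈ closedBall xb r, f xb + ((σ * dist x xb : ℝ) : EReal) ≤ f x) ∧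
    y = (σ : EReal)}

/-- `f` admits a local error bound at `xb` (where `f xb = 0`). -/
def HasLocalErrorBound {X : Type*} [MetricSpace X] (f : X → EReal) (xb : X) : Prop :=
  ∃ c : ℝ, 0 < c ∧ ∃ r : ℝ, 0 < r ∧ ∀ x ∈ ball xb r,
    (EMetric.infEdist x {y | f y ≤ 0} : EReal) ≤ (c : EReal) * max (f x) 0

/-- The error bound modulus `Er f(xb)`. -/
def errorBoundModulus {X : Type*} [MetricSpace X] (f : X → EReal) (xb : X) : EReal :=
  Filter.liminf
    (fun x => f x * (((EMetric.infEdist x {y | f y ≤ 0})⁻¹ : ℝ≥0∞) : EReal))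
    (𝓝[{x | 0 < f x}] xb)

/-- `‖φ‖_Lip ≤ L`. -/
def LipBound {X : Type*} [MetricSpace X] (φ : X → ℝ) (L : ℝ) : Prop :=
  ∀ x₁ x₂ : X, |φ x₁ - φ x₂| ≤ L * dist x₁ x₂

/-- `φ ∈ Lip(X)`. -/
def IsLip {X : Type*} [MetricSpace X] (φ : X → ℝ) : Prop := ∃ L : ℝ, LipBound φ L

/-- The (global) `Φ`-subdifferential `∂_Φ f(xb)`. -/
def PhiSubdiff {X : Type*} [MetricSpace X] (Φ : Set (X → ℝ)) (f : X → EReal) (xb : X) :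
    Set (X → ℝ) :=
  {φ | φ ∈ Φ ∧ ∀ x, f xb + ((φ x - φ xb : ℝ) : EReal) ≤ f x}

/-- `∂⁰_Φ f(xb)`, i.e. `∂⁰_{Φ,ε} f(xb)` with `ε = 0`. -/
def PhiSubdiff0 {X : Type*} [MetricSpace X] (Φ : Set (X → ℝ)) (f : X → EReal) (xb : X) :
    Set (X → ℝ) :=
  {φ | φ ∈ Φ ∧ ∃ r : ℝ, 0 < r ∧ ∀ x ∈ ball xb r, f xb + ((φ x - φ xb : ℝ) : EReal) ≤ f x}

/-- The local `Φ`-subdifferential `∂̂_Φ f(xb) = ⋂_{ε>0} ∂⁰_{Φ,ε} f(xb)`. -/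
def PhiSubdiffLoc {X : Type*} [MetricSpace X] (Φ : Set (X → ℝ)) (f : X → EReal) (xb : X) :
    Set (X → ℝ) :=
  {φ | φ ∈ Φ ∧ ∀ ε : ℝ, 0 < ε → ∃ r : ℝ, 0 < r ∧
    ∀ x ∈ ball xb r, f xb + ((φ x - φ xb - ε * dist x xb : ℝ) : EReal) ≤ f x}

/-- The supporting distance property with constant `κ`. -/
def SuppDistProp {X : Type*} [MetricSpace X] (Φ : Set (X → ℝ)) (κ : ℝ) : Prop :=
  ∀ ε : ℝ, 0 < ε → ∀ x xb : X,
    ε * dist x xb ≤ sSup {t : ℝ | ∃ φ ∈ Φ, LipBound φ (κ * ε) ∧ t = φ x - φ xb}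

/-- The local supporting distance property at `xb` with constant `κ`. -/
def LocSuppDistProp {X : Type*} [MetricSpace X] (Φ : Set (X → ℝ)) (κ : ℝ) (xb : X) : Prop :=
  ∀ ε : ℝ, 0 < ε → ∃ r : ℝ, 0 < r ∧ ∀ x ∈ ball xb r,
    ε * dist x xb ≤ sSup {t : ℝ | ∃ φ ∈ Φ, LipBound φ (κ * ε) ∧ t = φ x - φ xb}

/-- The pseudometric `d_Lip(φ,ψ) = ‖φ − ψ‖_Lip`, valued in `ℝ≥0∞`. -/
def dLip {X : Type*} [MetricSpace X] (φ ψ : X → ℝ) : ℝ≥0∞ :=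
  ⨆ (p : X × X) (_ : p.1 ≠ p.2),
    ENNReal.ofReal (|(φ p.1 - ψ p.1) - (φ p.2 - ψ p.2)| / dist p.1 p.2)

/-- Closed `d_Lip`-balls in `Φ` are (sequentially) compact. -/
def BallsCompact {X : Type*} [MetricSpace X] (Φ : Set (X → ℝ)) : Prop :=
  ∀ ψ ∈ Φ, ∀ ρ : ℝ≥0∞, ∀ u : ℕ → (X → ℝ),
    (∀ n, u n ∈ Φ ∧ dLip (u n) ψ ≤ ρ) →
    ∃ φ, φ ∈ Φ ∧ dLip φ ψ ≤ ρ ∧ ∃ s : ℕ → ℕ, StrictMono s ∧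
      Filter.Tendsto (fun k => dLip (u (s k)) φ) Filter.atTop (nhds 0)


end

lemma EReal.le_of_coe_sub_mul_inv_lt {b σ d : ℝ} {y : EReal} (hd : 0 < d)
    (h : ((b : EReal) - y) * ((d⁻¹ : ℝ) : EReal) < σ) : ((b - σ * d : ℝ) : EReal) ≤ y := by
  induction y with
  | bot =>
    rw [EReal.coe_sub_bot, EReal.top_mul_coe_of_pos (inv_pos.2 hd)] at h
    exact absurd h not_top_lt
  | top => exact le_top
  | coe y =>
    norm_cast at h ⊢
    rw [← div_eq_mul_inv, div_lt_iff₀ hd] at h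
    linarith

/-- A strong slope below `σ` bounds the local rate of decrease of the function by `σ`. -/
lemma eventually_sub_le_of_strongSlope_lt {X : Type*} [MetricSpace X] {g : X → EReal} {xb : X}
    {b σ : ℝ} (hb : g xb = b) (hσ : 0 < σ) (h : strongSlope g xb < σ) :
    ∀ᶠ x in 𝓝 xb, ((b - σ * dist x xb : ℝ) : EReal) ≤ g x := by
  unfold strongSlope at h
  split_ifs at h with hmin
  · filter_upwards [hmin] with x hx
    refine le_trans ?_ (hb ▸ hx)
    exact_mod_cast sub_le_self b (by positivity)
  · have hev := eventually_nhdsWithin_iff.1 (eventually_lt_of_limsup_lt h)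
    filter_upwards [hev] with x hx
    rcases eq_or_ne x xb with rfl | hne
    · simp [hb]
    · exact EReal.le_of_coe_sub_mul_inv_lt (dist_pos.2 hne) (hb ▸ hx hne)

lemma strongSlope_neg_mul_dist_le {X : Type*} [MetricSpace X] (xb : X) {c : ℝ} (hc : 0 ≤ c) :
    strongSlope (fun x => ((-(c * dist x xb) : ℝ) : EReal)) xb ≤ c := by
  unfold strongSlope
  split_ifs
  · exact_mod_cast hc
  · refine limsup_le_of_le (by isBoundedDefault) ?_
    filter_upwards [self_mem_nhdsWithin] with x hx
    have hd : dist x xb ≠ 0 := dist_ne_zero.2 hx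
    norm_cast
    simp [hd]

/-- `xb` is a local sharp minimizer of `f` iff `xb` is superstable, i.e.
there exists `ε₀ > 0` such that `xb` is a local minimizer of `f + g` for every `g` with
`g xb` finite and strong slope `|∇g|(xb) < ε₀`. -/
theorem sharpMin_iff_superstable {X : Type*} [MetricSpace X]
    (f : X → EReal) (xb : X) (hfin_top : f xb ≠ ⊤) (hfin_bot : f xb ≠ ⊥) :
    IsLocalSharpMin f xb ↔
      ∃ ε₀ : ℝ, 0 < ε₀ ∧ ∀ g : X → EReal, g xb ≠ ⊤ → g xb ≠ ⊥ →
        strongSlope g xb < (ε₀ : EReal) →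
        ∃ r : ℝ, 0 < r ∧ ∀ x ∈ ball xb r, f xb + g xb ≤ f x + g x := by
  lift f xb to ℝ using ⟨hfin_top, hfin_bot⟩ with a ha
  constructor
  · rintro ⟨σ, hσ, r, hr, hsharp⟩
    refine ⟨σ, hσ, fun g hg_top hg_bot hslope => ?_⟩
    lift g xb to ℝ using ⟨hg_top, hg_bot⟩ with b hb
    refine Metric.eventually_nhds_iff_ball.1 ?_
    filter_upwards [eventually_sub_le_of_strongSlope_lt hb.symm hσ hslope,
      closedBall_mem_nhds xb hr] with x hg hx
    have hf := hsharp x hx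
    rw [← ha] at hf
    refine le_trans (le_of_eq ?_) (add_le_add hf hg)
    norm_cast
    ring
  · rintro ⟨ε, hε, hstable⟩
    obtain ⟨r, hr, hmin⟩ := hstable (fun x => ((-(ε / 2 * dist x xb) : ℝ) : EReal))
      (EReal.coe_ne_top _) (EReal.coe_ne_bot _)
      ((strongSlope_neg_mul_dist_le xb (half_pos hε).le).trans_lt
        (by exact_mod_cast half_lt_self hε))
    refine ⟨ε / 2, half_pos hε, r / 2, half_pos hr, fun x hx => ?_⟩
    have h := hmin x (closedBall_subset_ball (half_lt_self hr) hx)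
    rw [← ha]
    generalize f x = y at h
    induction y with
    | bot => simp at h
    | top => exact le_top
    | coe y =>
      simp only [dist_self, mul_zero, neg_zero] at h
      norm_cast at h ⊢
      linarith
end

section
/- Let (X,d) be a metric space, f, g : X → ℝ ∪ {±∞}, and x̄ a point where both f(x̄) and g(x̄) are finite. If f↓(x̄) > 0 and the strong slope satisfies |∇g|(x̄) < f↓(x̄), then (f + g)↓(x̄) ≥ f↓(x̄) − |∇g|(x̄) > 0; in particular the perturbed function f + g still has x̄ as a local sharp minimizer. -/
open Filter Metric Set Topology
open scoped ENNReal RealInnerProductSpace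

/-- The limsup of the decrease quotients never exceeds the strong slope. -/
lemma limsup_le_strongSlope {X : Type*} [MetricSpace X] (g : X → EReal) (xb : X) :
    Filter.limsup (fun x => (g xb - g x) * (((dist x xb)⁻¹ : ℝ) : EReal)) (𝓝[≠] xb) ≤
      strongSlope g xb := by
  unfold strongSlope
  split_ifs with h
  · refine limsup_le_of_le (by isBoundedDefault) ?_
    filter_upwards [nhdsWithin_le_nhds h] with x hx
    refine mul_nonpos_of_nonpos_of_nonneg ?_ (by exact_mod_cast inv_nonneg.2 dist_nonneg)
    exact (EReal.sub_nonpos).2 hx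
  · exact le_rfl

lemma isLocalSharpMin_of_descentRate_pos {X : Type*} [MetricSpace X] (h : X → EReal) (xb : X)
    (h_top : h xb ≠ ⊤) (h_bot : h xb ≠ ⊥) (hpos : 0 < descentRate h xb) :
    IsLocalSharpMin h xb := by
  obtain ⟨σ, hσ0, hσ⟩ := EReal.lt_iff_exists_real_btwn.1 hpos
  have hev := eventually_lt_of_lt_liminf hσ
  rw [eventually_nhdsWithin_iff, Metric.nhds_basis_closedBall.eventually_iff] at hev
  obtain ⟨r, hr, H⟩ := hev
  refine ⟨σ, by exact_mod_cast hσ0, r, hr, fun x hx => ?_⟩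
  by_cases hne : x = xb
  · simp [hne]
  have hlt := H hx hne
  have hd : 0 < dist x xb := dist_pos.2 hne
  lift h xb to ℝ using ⟨h_top, h_bot⟩ with b
  clear H
  generalize h x = y at hlt ⊢
  induction y with
  | bot =>
    rw [EReal.bot_sub, EReal.bot_mul_coe_of_pos (inv_pos.2 hd)] at hlt
    exact absurd hlt not_lt_bot
  | top => exact le_top
  | coe a =>
    norm_cast at hlt ⊢
    rw [← div_eq_mul_inv, lt_div_iff₀ hd] at hlt
    linarith

/-- Difference quotients of a sum split, provided neither summand takes the value `⊥`. -/
lemma add_sub_add_mul_coe {u v : EReal} (a b : ℝ) {k : ℝ} (hk : 0 < k) (hu : u ≠ ⊥)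
    (hv : v ≠ ⊥) :
    (u + v - ((a : EReal) + b)) * (k : EReal) = (u - a) * k + -((b - v) * k) := by
  rw [← EReal.coe_add]
  induction u with
  | bot => exact absurd rfl hu
  | top =>
    induction v with
    | bot => exact absurd rfl hv
    | top =>
      rw [EReal.top_add_top, EReal.top_sub_coe, EReal.top_sub_coe, EReal.sub_top,
        EReal.top_mul_coe_of_pos hk, EReal.bot_mul_coe_of_pos hk, EReal.neg_bot,
        EReal.top_add_top]
    | coe v =>
      rw [EReal.top_add_coe, EReal.top_sub_coe, EReal.top_sub_coe, EReal.top_mul_coe_of_pos hk]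
      norm_cast
  | coe u =>
    induction v with
    | bot => exact absurd rfl hv
    | top =>
      rw [EReal.coe_add_top, EReal.top_sub_coe, EReal.sub_top, EReal.top_mul_coe_of_pos hk,
        EReal.bot_mul_coe_of_pos hk, EReal.neg_bot]
      norm_cast
    | coe v => norm_cast; ring

/-- if `f↓(xb) > 0` and `|∇g|(xb) < f↓(xb)`, then
`(f+g)↓(xb) ≥ f↓(xb) − |∇g|(xb) > 0`; in particular `f + g` still has `xb` as a local
sharp minimizer. -/
theorem descentRate_perturbed {X : Type*} [MetricSpace X]
    (f g : X → EReal) (xb : X)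
    (hf_top : f xb ≠ ⊤) (hf_bot : f xb ≠ ⊥) (hg_top : g xb ≠ ⊤) (hg_bot : g xb ≠ ⊥)
    (hC : 0 < descentRate f xb) (hslope : strongSlope g xb < descentRate f xb) :
    descentRate f xb - strongSlope g xb ≤ descentRate (fun x => f x + g x) xb ∧
    0 < descentRate f xb - strongSlope g xb ∧
    IsLocalSharpMin (fun x => f x + g x) xb := by
  have hL := limsup_le_strongSlope g xb
  have hs_top : strongSlope g xb ≠ ⊤ := hslope.ne_top
  have hpos : 0 < descentRate f xb - strongSlope g xb := EReal.sub_pos.2 hslope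
  have hle : descentRate f xb - strongSlope g xb ≤ descentRate (fun x => f x + g x) xb := by
    have hfe := eventually_lt_of_lt_liminf hC
    have hge := eventually_lt_of_limsup_lt (hL.trans_lt hs_top.lt_top)
    have hquot : (fun x => (f x + g x - (f xb + g xb)) * (((dist x xb)⁻¹ : ℝ) : EReal))
        =ᶠ[𝓝[≠] xb] (fun x => (f x - f xb) * (((dist x xb)⁻¹ : ℝ) : EReal)) +
          -(fun x => (g xb - g x) * (((dist x xb)⁻¹ : ℝ) : EReal)) := by
      filter_upwards [hfe, hge, self_mem_nhdsWithin] with x hfx hgx hx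
      have hk : 0 < (dist x xb)⁻¹ := inv_pos.2 (dist_pos.2 hx)
      simp only [Pi.add_apply, Pi.neg_apply]
      lift f xb to ℝ using ⟨hf_top, hf_bot⟩ with a
      lift g xb to ℝ using ⟨hg_top, hg_bot⟩ with b
      refine add_sub_add_mul_coe a b hk ?_ ?_
      · intro h
        rw [h, EReal.bot_sub, EReal.bot_mul_coe_of_pos hk] at hfx
        exact not_lt_bot hfx
      · intro h
        rw [h, EReal.coe_sub_bot, EReal.top_mul_coe_of_pos hk] at hgx
        exact lt_irrefl _ hgx
    have hneg := EReal.neg_le_neg_iff.2 hL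
    rw [← EReal.liminf_neg] at hneg
    refine le_trans ?_ (EReal.le_liminf_add.trans_eq (liminf_congr hquot).symm)
    rw [sub_eq_add_neg]
    exact add_le_add le_rfl hneg
  refine ⟨hle, hpos, isLocalSharpMin_of_descentRate_pos _ xb ?_ ?_ (hpos.trans_le hle)⟩
  · exact EReal.add_ne_top hf_top hg_top
  · simp [EReal.add_eq_bot_iff, hf_bot, hg_bot]
end

section
/- Let (X,d) be a complete metric space and f : X → ℝ ∪ {+∞} a lower semicontinuous function with inf_X f > −∞. If there exists σ > 0 such that sup { f↓(x) : x ∈ X, f(x) finite, f(x) > inf_X f } < −σ, then f attains its global minimum, i.e. Argmin(f) = {x : f(x) ≤ inf_X f} is nonempty. -/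
open Filter Metric Set Topology
open scoped ENNReal RealInnerProductSpace

/-- Among the `x ∈ s`, some value of `g` is at most halfway between `g a` and every other value. -/
theorem exists_add_self_le_add {α : Type*} {s : Set α} {g : α → ℝ} {a : α} {m : ℝ}
    (ha : a ∈ s) (hm : ∀ x, m ≤ g x) :
    ∃ y ∈ s, ∀ z ∈ s, g y + g y ≤ g a + g z := by
  have hbd : BddBelow (g '' s) := ⟨m, by rintro _ ⟨x, -, rfl⟩; exact hm x⟩
  have hle : ∀ z ∈ s, sInf (g '' s) ≤ g z := fun z hz => csInf_le hbd ⟨z, hz, rfl⟩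
  rcases (hle a ha).eq_or_lt with h | h
  · exact ⟨a, ha, fun z hz => by linarith [hle z hz]⟩
  · obtain ⟨_, ⟨y, hy, rfl⟩, hlt⟩ := exists_lt_of_csInf_lt (Set.Nonempty.image g ⟨a, ha⟩)
      (show sInf (g '' s) < (g a + sInf (g '' s)) / 2 by linarith)
    exact ⟨y, hy, fun z hz => by linarith [hle z hz]⟩

/-- A form of Ekeland's variational principle: a proper lower semicontinuous function bounded below
on a complete metric space has, for each `σ > 0`, a point minimizing its perturbation by `σ` times
the distance to that point. -/
theorem exists_forall_le_add_mul_dist {X : Type*} [MetricSpace X] [CompleteSpace X]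
    {f : X → EReal} (hlsc : LowerSemicontinuous f) {m : ℝ} (hm : ∀ x, (m : EReal) ≤ f x)
    {a : X} (ha : f a ≠ ⊤) {σ : ℝ} (hσ : 0 < σ) :
    ∃ x, f x ≠ ⊤ ∧ ∀ y, f x ≤ f y + ((σ * dist y x : ℝ) : EReal) := by
  let D := {x : X // f x ≠ ⊤}
  let g : D → ℝ := fun x => (f x).toReal
  have hg : ∀ x : D, f x = (g x : EReal) := fun x =>
    (EReal.coe_toReal x.2 (ne_bot_of_le_ne_bot (EReal.coe_ne_bot m) (hm x))).symm
  have hgm : ∀ x, m ≤ g x := fun x => by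
    have := hm x
    rw [hg] at this
    exact_mod_cast this
  let S : D → Set D := fun x => {y | g y + σ * dist y x ≤ g x}
  have hself : ∀ x, x ∈ S x := fun x => by simp [S]
  have htrans : ∀ {x y z : D}, y ∈ S x → z ∈ S y → z ∈ S x := by
    intro x y z hy hz
    simp only [S, mem_ofPred_eq] at *
    nlinarith [dist_triangle z y x]
  choose next hnext hhalf using fun x => exists_add_self_le_add (hself x) hgm
  let u : ℕ → D := fun n => next^[n] ⟨a, ha⟩
  have hu : ∀ n, u (n + 1) = next (u n) := fun n => Function.iterate_succ_apply' next n _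
  have hmem : ∀ {n k}, n ≤ k → u k ∈ S (u n) := by
    intro n k h
    induction k, h using Nat.le_induction with
    | base => exact hself _
    | succ k _ ih => exact htrans ih (hu k ▸ hnext (u k))
  have hanti : Antitone (g ∘ u) := fun n k h => by
    have h1 : g (u k) + σ * dist (u k) (u n) ≤ g (u n) := hmem h
    have := mul_nonneg hσ.le (dist_nonneg (x := u k) (y := u n))
    simp only [Function.comp_apply]
    linarith
  obtain ⟨L, hL⟩ : ∃ L, Tendsto (g ∘ u) atTop (𝓝 L) :=
    ⟨_, tendsto_atTop_ciInf hanti ⟨m, by rintro _ ⟨n, rfl⟩; exact hgm _⟩⟩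
  have hLle : ∀ n, L ≤ g (u n) := hanti.le_of_tendsto hL
  have hcauchy : CauchySeq fun n => (u n : X) := by
    refine cauchySeq_of_le_tendsto_0' (fun n => (g (u n) - L) / σ) (fun n k h => ?_) ?_
    · have h1 : g (u k) + σ * dist (u k) (u n) ≤ g (u n) := hmem h
      rw [le_div_iff₀ hσ, dist_comm]
      have h2 : dist (u k) (u n) = dist (u k : X) (u n) := rfl
      rw [h2] at h1
      linarith [hLle k]
    · simpa using (hL.sub_const L).div_const σ
  obtain ⟨x, hx⟩ := cauchySeq_tendsto_of_complete hcauchy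
  have hfx : f x ≤ (L : EReal) := by
    by_contra! h
    obtain ⟨c, hLc, hcf⟩ := EReal.lt_iff_exists_real_btwn.1 h
    obtain ⟨n, h1, h2⟩ := ((hx.eventually (hlsc x c hcf)).and
      (hL.eventually_lt_const (EReal.coe_lt_coe_iff.1 hLc))).exists
    rw [hg] at h1
    exact lt_asymm h2 (EReal.coe_lt_coe_iff.1 h1)
  have hxtop : f x ≠ ⊤ := ne_top_of_le_ne_top (EReal.coe_ne_top L) hfx
  let xb : D := ⟨x, hxtop⟩
  have hgx : g xb ≤ L := by
    have := hg xb
    exact EReal.coe_le_coe_iff.1 (this ▸ hfx)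
  have hxS : ∀ n, xb ∈ S (u n) := fun n => by
    have h1 : Tendsto (fun k => g (u k) + σ * dist (u k : X) (u n)) atTop
        (𝓝 (L + σ * dist x (u n))) := hL.add ((hx.dist tendsto_const_nhds).const_mul σ)
    have h2 : L + σ * dist x (u n) ≤ g (u n) :=
      le_of_tendsto h1 (eventually_atTop.2 ⟨n, fun k h => hmem h⟩)
    change g xb + σ * dist x (u n) ≤ g (u n)
    linarith
  refine ⟨x, hxtop, fun y => ?_⟩
  by_cases hy : f y = ⊤
  · rw [hy, EReal.top_add_coe]
    exact le_top
  let yb : D := ⟨y, hy⟩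
  have key : g xb ≤ g yb + σ * dist y x := by
    by_contra! h
    have hyS : yb ∈ S xb → L ≤ g yb := fun hyS => by
      have h1 : ∀ n, g (u (n + 1)) + g (u (n + 1)) ≤ g (u n) + g yb := fun n =>
        hu n ▸ hhalf (u n) yb (htrans (hxS n) hyS)
      have h2 := hL.comp (tendsto_add_atTop_nat 1)
      have := le_of_tendsto_of_tendsto' (h2.add h2) (hL.add_const (g yb)) h1
      linarith
    have := hyS h.le
    have := mul_nonneg hσ.le (dist_nonneg (x := y) (y := x))
    linarith
  have e1 : f x = (g xb : EReal) := hg xb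
  have e2 : f y = (g yb : EReal) := hg yb
  rw [e1, e2]
  exact_mod_cast key

/-- A `σ`-Ekeland point has steepest descent rate at least `-σ`. -/
theorem neg_le_descentRate {X : Type*} [MetricSpace X] {f : X → EReal} (hbot : ∀ y, f y ≠ ⊥)
    {x : X} (hx : f x ≠ ⊤) {σ : ℝ} (h : ∀ y, f x ≤ f y + ((σ * dist y x : ℝ) : EReal)) :
    ((-σ : ℝ) : EReal) ≤ descentRate f x := by
  refine le_liminf_of_le (by isBoundedDefault) ?_
  filter_upwards [self_mem_nhdsWithin] with y hy
  have hd : 0 < dist y x := dist_pos.2 hy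
  have hxy := h y
  lift f x to ℝ using ⟨hx, hbot x⟩ with b
  by_cases hty : f y = ⊤
  · rw [hty, EReal.top_sub_coe, EReal.top_mul_coe_of_pos (inv_pos.2 hd)]
    exact le_top
  lift f y to ℝ using ⟨hty, hbot y⟩ with c
  norm_cast at hxy ⊢
  rw [← div_eq_mul_inv, le_div_iff₀ hd]
  linarith

/-- on a complete metric space, if `f` is l.s.c., bounded below and the
steepest descent rates on the strict superlevel set of `inf f` have supremum `< −σ`
for some `σ > 0`, then `Argmin f` is nonempty. -/
theorem argmin_nonempty_of_descentRate_lt_neg {X : Type*} [MetricSpace X] [CompleteSpace X]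
    [Nonempty X] (f : X → EReal) (hbot : ∀ x, f x ≠ ⊥) (hlsc : LowerSemicontinuous f)
    (hbdd : ⊥ < ⨅ x, f x) (σ : ℝ) (hσ : 0 < σ)
    (hsup : sSup {y : EReal | ∃ x : X, f x ≠ ⊤ ∧ (⨅ z, f z) < f x ∧ y = descentRate f x}
      < ((-σ : ℝ) : EReal)) :
    {x : X | f x ≤ ⨅ z, f z}.Nonempty := by
  by_cases htop : ∀ x, f x = ⊤
  · exact ‹Nonempty X›.elim fun x => ⟨x, by simp [htop]⟩
  obtain ⟨a, ha⟩ := not_forall.1 htop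
  obtain ⟨m, -, hm⟩ := EReal.lt_iff_exists_real_btwn.1 hbdd
  obtain ⟨x, hx, hmin⟩ := exists_forall_le_add_mul_dist hlsc
    (fun y => hm.le.trans (iInf_le f y)) ha hσ
  refine ⟨x, show f x ≤ ⨅ z, f z from ?_⟩
  by_contra! hlt
  exact (hsup.trans_le (neg_le_descentRate hbot hx hmin)).not_ge (le_sSup ⟨x, hx, hlt, rfl⟩)
end

section
/- Let (X,d) be a metric space, f : X → ℝ ∪ {±∞}, and x̄ a point with f(x̄) = 0. If f↓(x̄) > 0, then f admits a local error bound at x̄, and moreover f↓(x̄) ≤ Er f(x̄), where Er f(x̄) is the error bound modulus of f at x̄. -/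
open Filter Metric Set Topology
open scoped ENNReal RealInnerProductSpace

theorem real_mul_lt_of_lt_mul_inv {a : EReal} {s d : ℝ} (hd : 0 < d)
    (h : (s : EReal) < a * ((d⁻¹ : ℝ) : EReal)) : ((s * d : ℝ) : EReal) < a := by
  induction a with
  | bot => simp [EReal.bot_mul_coe_of_pos (inv_pos.2 hd)] at h
  | top => exact EReal.coe_lt_top _
  | coe a =>
    rw [← EReal.coe_mul, EReal.coe_lt_coe_iff, ← div_eq_mul_inv, lt_div_iff₀ hd] at h
    exact EReal.coe_lt_coe_iff.2 h

theorem coe_infEDist_le_dist {X : Type*} [MetricSpace X] {S : Set X} {x y : X} (hy : y ∈ S) :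
    (Metric.infEDist x S : EReal) ≤ ((dist x y : ℝ) : EReal) := by
  have h : Metric.infEDist x S ≤ ENNReal.ofReal (dist x y) :=
    (Metric.infEDist_le_edist_of_mem hy).trans_eq (edist_dist x y)
  simpa using EReal.coe_ennreal_le_coe_ennreal_iff.2 h

theorem inv_dist_le_coe_inv_infEDist {X : Type*} [MetricSpace X] {S : Set X} {x y : X}
    (hy : y ∈ S) (hxy : x ≠ y) :
    (((dist x y)⁻¹ : ℝ) : EReal) ≤ (((Metric.infEDist x S)⁻¹ : ℝ≥0∞) : EReal) := by
  have h : ENNReal.ofReal (dist x y)⁻¹ ≤ (Metric.infEDist x S)⁻¹ := by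
    rw [ENNReal.ofReal_inv_of_pos (dist_pos.2 hxy), ← edist_dist]
    exact ENNReal.inv_le_inv.2 (Metric.infEDist_le_edist_of_mem hy)
  simpa using EReal.coe_ennreal_le_coe_ennreal_iff.2 h

theorem hasLocalErrorBound_of_descentRate_pos {X : Type*} [MetricSpace X]
    {f : X → EReal} {xb : X} (h0 : f xb = 0) (hC : 0 < descentRate f xb) :
    HasLocalErrorBound f xb := by
  obtain ⟨s, hs0, hs⟩ := EReal.lt_iff_exists_real_btwn.1 hC
  have hs0 : 0 < s := EReal.coe_pos.1 hs0
  have hev := eventually_lt_of_lt_liminf hs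
  rw [eventually_nhdsWithin_iff, Metric.eventually_nhds_iff_ball] at hev
  obtain ⟨r, hr, hball⟩ := hev
  have hxb : xb ∈ {y | f y ≤ 0} := h0.le
  refine ⟨s⁻¹, inv_pos.2 hs0, r, hr, fun x hx => ?_⟩
  refine (coe_infEDist_le_dist hxb).trans ?_
  have hs1 : (0 : EReal) ≤ ((s⁻¹ : ℝ) : EReal) := EReal.coe_nonneg.2 (inv_pos.2 hs0).le
  rcases eq_or_ne x xb with rfl | hne
  · simp [h0]
  · have h := hball x hx hne
    rw [h0, sub_zero] at h
    calc ((dist x xb : ℝ) : EReal) = ((s⁻¹ : ℝ) : EReal) * ((s * dist x xb : ℝ) : EReal) := by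
          rw [← EReal.coe_mul, inv_mul_cancel_left₀ hs0.ne']
      _ ≤ ((s⁻¹ : ℝ) : EReal) * max (f x) 0 :=
          mul_le_mul_of_nonneg_left
            ((real_mul_lt_of_lt_mul_inv (dist_pos.2 hne) h).le.trans (le_max_left _ _)) hs1

theorem descentRate_le_errorBoundModulus {X : Type*} [MetricSpace X]
    {f : X → EReal} {xb : X} (h0 : f xb = 0) : descentRate f xb ≤ errorBoundModulus f xb := by
  have hxb : xb ∈ {y | f y ≤ 0} := h0.le
  have hne : ∀ x ∈ {x | 0 < f x}, x ≠ xb := by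
    rintro x hx rfl
    exact (h0 ▸ hx : (0 : EReal) < 0).false
  refine (liminf_le_liminf_of_le (nhdsWithin_mono xb hne)).trans
    (liminf_le_liminf (eventually_nhdsWithin_of_forall fun x hx => ?_))
  rw [h0, sub_zero]
  exact mul_le_mul_of_nonneg_left (inv_dist_le_coe_inv_infEDist hxb (hne x hx)) (le_of_lt hx)

/-- if `f xb = 0` and `f↓(xb) > 0`, then `f` admits a local error bound at
`xb` and `f↓(xb) ≤ Er f(xb)`. -/
theorem errorBound_of_positive_descentRate {X : Type*} [MetricSpace X]
    (f : X → EReal) (xb : X) (h0 : f xb = 0) (hC : 0 < descentRate f xb) :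
    HasLocalErrorBound f xb ∧ descentRate f xb ≤ errorBoundModulus f xb :=
  ⟨hasLocalErrorBound_of_descentRate_pos h0 hC, descentRate_le_errorBoundModulus h0⟩
end

section
/- Let (X,d) be a metric space, f : X → ℝ ∪ {±∞} with f(x̄) = 0 and f↓(x̄) > 0. Then for every g : X → ℝ ∪ {±∞} with g(x̄) = 0 and strong slope |∇g|(x̄) < f↓(x̄), the perturbed function f + g admits a local error bound at x̄, and moreover f↓(x̄) − |∇g|(x̄) ≤ Er (f+g)(x̄). -/
open Filter Metric Set Topology
open scoped ENNReal RealInnerProductSpace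

theorem EReal.coe_mul_lt_of_lt_mul_coe_inv {a : EReal} {t d : ℝ} (hd : 0 < d)
    (h : (t : EReal) < a * ((d⁻¹ : ℝ) : EReal)) : ((t * d : ℝ) : EReal) < a := by
  have hd' : 0 < d⁻¹ := inv_pos.2 hd
  induction a with
  | bot => simp [EReal.bot_mul_coe_of_pos hd'] at h
  | top => exact EReal.coe_lt_top _
  | coe a =>
    norm_cast at h ⊢
    rwa [← div_eq_mul_inv, lt_div_iff₀ hd] at h

theorem EReal.lt_of_mul_coe_inv_lt {a : EReal} {s d : ℝ} (hd : 0 < d)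
    (h : (0 - a) * ((d⁻¹ : ℝ) : EReal) < (s : EReal)) : ((-(s * d) : ℝ) : EReal) < a := by
  have hd' : 0 < d⁻¹ := inv_pos.2 hd
  induction a with
  | bot => simp [EReal.top_mul_coe_of_pos hd'] at h
  | top => exact EReal.coe_lt_top _
  | coe a =>
    norm_cast at h ⊢
    rw [← div_eq_mul_inv, div_lt_iff₀ hd] at h
    linarith

theorem eventually_le_of_lt_descentRate {X : Type*} [MetricSpace X] {f : X → EReal} {xb : X}
    (h0 : f xb = 0) {t : ℝ} (ht : (t : EReal) < descentRate f xb) :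
    ∀ᶠ x in 𝓝 xb, ((t * dist x xb : ℝ) : EReal) ≤ f x := by
  filter_upwards [eventually_nhdsWithin_iff.1 (eventually_lt_of_lt_liminf ht)] with x hx
  rcases eq_or_ne x xb with rfl | hne
  · simp [h0]
  · have h := hx hne
    rw [h0, sub_zero] at h
    exact (EReal.coe_mul_lt_of_lt_mul_coe_inv (dist_pos.2 hne) h).le

theorem strongSlope_nonneg {X : Type*} [MetricSpace X] (g : X → EReal) (xb : X) :
    0 ≤ strongSlope g xb := by
  unfold strongSlope
  split_ifs with h
  · exact le_rfl
  · refine le_limsup_of_frequently_le ?_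
    rw [Filter.Frequently, eventually_nhdsWithin_iff]
    refine fun h' => h (h'.mono fun x hx => ?_)
    rcases eq_or_ne x xb with rfl | hne
    · exact le_rfl
    · by_contra! hlt
      refine hx hne (mul_nonneg
        ((EReal.sub_nonneg (.inr hlt.ne_top) (.inl hlt.ne_bot)).2 hlt.le) ?_)
      exact_mod_cast inv_nonneg.2 dist_nonneg

theorem eventually_le_of_strongSlope_lt {X : Type*} [MetricSpace X] {g : X → EReal} {xb : X}
    (h0 : g xb = 0) {s : ℝ} (hs : strongSlope g xb < s) :
    ∀ᶠ x in 𝓝 xb, ((-(s * dist x xb) : ℝ) : EReal) ≤ g x := by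
  have hs0 : 0 ≤ s := by exact_mod_cast (strongSlope_nonneg g xb).trans hs.le
  unfold strongSlope at hs
  split_ifs at hs with h
  · filter_upwards [h] with x hx
    rw [h0] at hx
    refine le_trans ?_ hx
    exact_mod_cast neg_nonpos.2 (mul_nonneg hs0 dist_nonneg)
  · filter_upwards [eventually_nhdsWithin_iff.1 (eventually_lt_of_limsup_lt hs)] with x hx
    rcases eq_or_ne x xb with rfl | hne
    · simp [h0]
    · have h := hx hne
      rw [h0] at h
      exact (EReal.lt_of_mul_coe_inv_lt (dist_pos.2 hne) h).le

theorem HasLocalErrorBound.of_eventually_le {X : Type*} [MetricSpace X] {h : X → EReal} {xb : X}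
    (h0 : h xb = 0) {σ : ℝ} (hσ : 0 < σ)
    (hle : ∀ᶠ x in 𝓝 xb, ((σ * dist x xb : ℝ) : EReal) ≤ h x) : HasLocalErrorBound h xb := by
  obtain ⟨r, hr, H⟩ := Metric.eventually_nhds_iff_ball.1 hle
  refine ⟨σ⁻¹, inv_pos.2 hσ, r, hr, fun x hx => ?_⟩
  have hmem : xb ∈ {y | h y ≤ 0} := h0.le
  calc ((Metric.infEDist x {y | h y ≤ 0} : ℝ≥0∞) : EReal)
      ≤ ((edist x xb : ℝ≥0∞) : EReal) :=
        EReal.coe_ennreal_le_coe_ennreal_iff.2 (Metric.infEDist_le_edist_of_mem hmem)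
    _ = ((dist x xb : ℝ) : EReal) := by
        rw [edist_dist, EReal.coe_ennreal_ofReal, max_eq_left dist_nonneg]
    _ = ((σ⁻¹ : ℝ) : EReal) * ((σ * dist x xb : ℝ) : EReal) := by
        rw [← EReal.coe_mul, inv_mul_cancel_left₀ hσ.ne']
    _ ≤ ((σ⁻¹ : ℝ) : EReal) * max (h x) 0 :=
        mul_le_mul_of_nonneg_left ((H x hx).trans (le_max_left _ _))
          (by exact_mod_cast (inv_pos.2 hσ).le)

theorem le_errorBoundModulus_of_eventually_le {X : Type*} [MetricSpace X] {h : X → EReal} {xb : X}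
    (h0 : h xb = 0) {σ : ℝ}
    (hle : ∀ᶠ x in 𝓝 xb, ((σ * dist x xb : ℝ) : EReal) ≤ h x) :
    (σ : EReal) ≤ errorBoundModulus h xb := by
  refine le_liminf_of_le (h := eventually_nhdsWithin_iff.2 ?_)
  filter_upwards [hle] with x hx hpos
  have hpos : 0 < h x := hpos
  have hne : x ≠ xb := by
    rintro rfl
    exact hpos.ne' h0
  have hd : 0 < dist x xb := dist_pos.2 hne
  have hmem : xb ∈ {y | h y ≤ 0} := h0.le
  calc (σ : EReal) = ((σ * dist x xb : ℝ) : EReal) * (((dist x xb)⁻¹ : ℝ) : EReal) := by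
        rw [← EReal.coe_mul, mul_inv_cancel_right₀ hd.ne']
    _ ≤ h x * (((dist x xb)⁻¹ : ℝ) : EReal) :=
        mul_le_mul_of_nonneg_right hx (by exact_mod_cast (inv_pos.2 hd).le)
    _ = h x * (((edist x xb)⁻¹ : ℝ≥0∞) : EReal) := by
        rw [edist_dist, ← ENNReal.ofReal_inv_of_pos hd, EReal.coe_ennreal_ofReal,
          max_eq_left (inv_pos.2 hd).le]
    _ ≤ h x * (((Metric.infEDist x {y | h y ≤ 0})⁻¹ : ℝ≥0∞) : EReal) :=
        mul_le_mul_of_nonneg_left (EReal.coe_ennreal_le_coe_ennreal_iff.2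
          (ENNReal.inv_le_inv.2 (Metric.infEDist_le_edist_of_mem hmem))) hpos.le

/-- if `f xb = 0` and `f↓(xb) > 0`, then for every `g` with `g xb = 0` and
`|∇g|(xb) < f↓(xb)`, the function `f + g` admits a local error bound at `xb` and
`f↓(xb) − |∇g|(xb) ≤ Er (f+g)(xb)`. -/
theorem errorBound_stable_under_perturbation {X : Type*} [MetricSpace X]
    (f : X → EReal) (xb : X) (h0 : f xb = 0) (hC : 0 < descentRate f xb) :
    ∀ g : X → EReal, g xb = 0 → strongSlope g xb < descentRate f xb →
      HasLocalErrorBound (fun x => f x + g x) xb ∧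
      descentRate f xb - strongSlope g xb ≤ errorBoundModulus (fun x => f x + g x) xb := by
  intro g hg hlt
  have h_sum : (fun x => f x + g x) xb = 0 := by simp [h0, hg]
  have key : ∀ s t : ℝ, strongSlope g xb < s → (t : EReal) < descentRate f xb →
      ∀ᶠ x in 𝓝 xb, (((t - s) * dist x xb : ℝ) : EReal) ≤ f x + g x := by
    intro s t hs ht
    filter_upwards [eventually_le_of_lt_descentRate h0 ht,
      eventually_le_of_strongSlope_lt hg hs] with x hfx hgx
    have h := add_le_add hfx hgx
    rwa [← EReal.coe_add, ← sub_eq_add_neg, ← sub_mul] at h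
  constructor
  · obtain ⟨s, hs, hs'⟩ := EReal.lt_iff_exists_real_btwn.1 hlt
    obtain ⟨t, hst, ht⟩ := EReal.lt_iff_exists_real_btwn.1 hs'
    exact .of_eventually_le h_sum (sub_pos.2 (EReal.coe_lt_coe_iff.1 hst)) (key s t hs ht)
  · obtain ⟨S, hS⟩ : ∃ S : ℝ, (S : EReal) = strongSlope g xb :=
      ⟨_, EReal.coe_toReal hlt.ne_top
        ((EReal.bot_lt_zero.trans_le (strongSlope_nonneg g xb)).ne')⟩
    refine EReal.ge_of_forall_gt_iff_ge.1 fun c hc => ?_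
    rw [← hS] at hc key
    have hcS : ((c + S : ℝ) : EReal) < descentRate f xb := by
      rw [EReal.coe_add]
      exact EReal.add_lt_of_lt_sub hc
    obtain ⟨t, hct, ht⟩ := EReal.lt_iff_exists_real_btwn.1 hcS
    rw [EReal.coe_lt_coe_iff] at hct
    have h := le_errorBoundModulus_of_eventually_le (xb := xb) h_sum
      (key (t - c) t (EReal.coe_lt_coe_iff.2 (by linarith)) ht)
    rwa [sub_sub_cancel] at h
end

section
/- Let (X,d) be a metric space, f : X → ℝ ∪ {±∞}, x̄ with f(x̄) finite, and Φ ⊆ Lip(X) a family of Lipschitz functions containing the zero function. If f↓(x̄) > 0, then for every σ ∈ (0, f↓(x̄)) and every φ ∈ Φ with ‖φ‖_Lip ≤ σ one has φ ∈ ∂⁰_Φ f(x̄); in particular the zero function lies in the interior of ∂⁰_Φ f(x̄) with respect to the pseudometric d_Lip on Φ. -/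
open Filter Metric Set Topology
open scoped ENNReal RealInnerProductSpace

theorem exists_ball_linear_growth_of_lt_descentRate {X : Type*} [MetricSpace X]
    {f : X → EReal} {xb : X} (hf_top : f xb ≠ ⊤) (hf_bot : f xb ≠ ⊥)
    {σ : ℝ} (hσ : (σ : EReal) < descentRate f xb) :
    ∃ r : ℝ, 0 < r ∧ ∀ x ∈ ball xb r, f xb + ((σ * dist x xb : ℝ) : EReal) ≤ f x := by
  have hev := Filter.eventually_lt_of_lt_liminf hσ
  rw [eventually_nhdsWithin_iff, Metric.eventually_nhds_iff_ball] at hev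
  obtain ⟨r, hr, hball⟩ := hev
  refine ⟨r, hr, fun x hx => ?_⟩
  lift f xb to ℝ using ⟨hf_top, hf_bot⟩ with a ha
  rcases eq_or_ne x xb with rfl | hne
  · simp [← ha]
  have hd : 0 < dist x xb := dist_pos.mpr hne
  have h := hball x hx hne
  generalize f x = y at h ⊢
  induction y with
  | bot =>
    rw [EReal.bot_sub, EReal.bot_mul_coe_of_pos (inv_pos.mpr hd)] at h
    exact absurd h not_lt_bot
  | top => exact le_top
  | coe b =>
    norm_cast at h ⊢
    rw [← div_eq_mul_inv, lt_div_iff₀ hd] at h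
    linarith

/-- if `f↓(xb) > 0` then every `φ ∈ Φ` with `‖φ‖_Lip ≤ σ`, for any
`σ ∈ (0, f↓(xb))`, belongs to `∂⁰_Φ f(xb)`; in particular the zero function lies in the
`d_Lip`-interior of `∂⁰_Φ f(xb)`. -/
theorem zero_mem_interior_subdiff0_of_positive_descentRate {X : Type*} [MetricSpace X]
    (f : X → EReal) (xb : X) (hf_top : f xb ≠ ⊤) (hf_bot : f xb ≠ ⊥)
    (Φ : Set (X → ℝ)) (hΦ : ∀ φ ∈ Φ, IsLip φ) (h0Φ : (fun _ : X => (0:ℝ)) ∈ Φ)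
    (hC : 0 < descentRate f xb) :
    (∀ σ : ℝ, 0 < σ → (σ : EReal) < descentRate f xb →
      ∀ φ ∈ Φ, LipBound φ σ → φ ∈ PhiSubdiff0 Φ f xb) ∧
    (∃ ε : ℝ, 0 < ε ∧ ∀ φ ∈ Φ, LipBound φ ε → φ ∈ PhiSubdiff0 Φ f xb) := by
  have key : ∀ σ : ℝ, 0 < σ → (σ : EReal) < descentRate f xb →
      ∀ φ ∈ Φ, LipBound φ σ → φ ∈ PhiSubdiff0 Φ f xb := by
    intro σ _ hlt φ hφ hLip
    obtain ⟨r, hr, hgrowth⟩ := exists_ball_linear_growth_of_lt_descentRate hf_top hf_bot hlt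
    refine ⟨hφ, r, hr, fun x hx => le_trans ?_ (hgrowth x hx)⟩
    gcongr
    exact (le_abs_self _).trans (hLip x xb)
  refine ⟨key, ?_⟩
  obtain ⟨σ, hσ, hlt⟩ := EReal.lt_iff_exists_real_btwn.mp hC
  have hpos : 0 < σ := by exact_mod_cast hσ
  exact ⟨σ, hpos, key σ hpos hlt⟩
end

section
/- Let (X,d) be a metric space, f : X → ℝ ∪ {±∞}, x̄ with f(x̄) finite, and Φ ⊆ Lip(X) a family containing the zero function and satisfying the supporting distance property with constant κ > 0. If there exists ε > 0 such that every φ ∈ Φ with ‖φ‖_Lip ≤ ε belongs to the Φ-subdifferential ∂_Φ f(x̄), then f↓(x̄) ≥ ε/κ > 0; indeed f(x) − f(x̄) ≥ (ε/κ) d(x, x̄) for all x ∈ X. -/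
open Filter Metric Set Topology
open scoped ENNReal RealInnerProductSpace

/-- Under the supporting distance property, a real bound for all increments `φ x - φ y` of
`ε`-Lipschitz members of `Φ` is also a bound for `ε / κ * dist x y`. -/
theorem SuppDistProp.div_mul_dist_le {X : Type*} [MetricSpace X] {Φ : Set (X → ℝ)} {κ ε b : ℝ}
    (hsd : SuppDistProp Φ κ) (hκ : 0 < κ) (hε : 0 < ε) (h0Φ : (fun _ : X => (0 : ℝ)) ∈ Φ)
    {x y : X} (hb : ∀ φ ∈ Φ, LipBound φ ε → φ x - φ y ≤ b) : ε / κ * dist x y ≤ b := by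
  refine (hsd (ε / κ) (div_pos hε hκ) x y).trans (csSup_le ?_ ?_)
  · refine ⟨0, _, h0Φ, fun x₁ x₂ => ?_, by simp⟩
    simpa using by positivity
  · rintro t ⟨φ, hφ, hL, rfl⟩
    rw [mul_div_cancel₀ ε hκ.ne'] at hL
    exact hb φ hφ hL

/-- Linear growth of `f` at `xb` with rate `c` bounds the steepest descent rate below by `c`. -/
theorem le_descentRate {X : Type*} [MetricSpace X] {f : X → EReal} {xb : X} {c : ℝ}
    (hf_top : f xb ≠ ⊤) (hf_bot : f xb ≠ ⊥)
    (h : ∀ x, f xb + ((c * dist x xb : ℝ) : EReal) ≤ f x) : (c : EReal) ≤ descentRate f xb := by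
  refine le_liminf_of_le (by isBoundedDefault) ?_
  filter_upwards [self_mem_nhdsWithin] with x hx
  have hd : 0 < dist x xb := dist_pos.2 hx
  have hsub : ((c * dist x xb : ℝ) : EReal) ≤ f x - f xb := by
    rw [EReal.le_sub_iff_add_le (Or.inl hf_bot) (Or.inl hf_top), add_comm]
    exact h x
  calc (c : EReal) = ((c * dist x xb : ℝ) : EReal) * (((dist x xb)⁻¹ : ℝ) : EReal) := by
        rw [← EReal.coe_mul, mul_inv_cancel_right₀ hd.ne']
    _ ≤ _ := mul_le_mul_of_nonneg_right hsub (EReal.coe_nonneg.2 (inv_nonneg.2 hd.le))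

/-- if `Φ` contains the zero function and satisfies the supporting distance
property with constant `κ > 0`, and every `φ ∈ Φ` with `‖φ‖_Lip ≤ ε` belongs to
`∂_Φ f(xb)`, then `f↓(xb) ≥ ε/κ > 0`; indeed `f x − f xb ≥ (ε/κ) d(x, xb)` on all of `X`. -/
theorem positive_descentRate_of_subdiff_ball {X : Type*} [MetricSpace X]
    (f : X → EReal) (xb : X) (hf_top : f xb ≠ ⊤) (hf_bot : f xb ≠ ⊥)
    (Φ : Set (X → ℝ)) (hΦ : ∀ φ ∈ Φ, IsLip φ) (h0Φ : (fun _ : X => (0:ℝ)) ∈ Φ)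
    (κ : ℝ) (hκ : 0 < κ) (hsd : SuppDistProp Φ κ)
    (ε : ℝ) (hε : 0 < ε) (hsub : ∀ φ ∈ Φ, LipBound φ ε → φ ∈ PhiSubdiff Φ f xb) :
    (∀ x : X, f xb + ((ε / κ * dist x xb : ℝ) : EReal) ≤ f x) ∧
    ((ε / κ : ℝ) : EReal) ≤ descentRate f xb ∧ 0 < descentRate f xb := by
  have growth : ∀ x : X, f xb + ((ε / κ * dist x xb : ℝ) : EReal) ≤ f x := by
    intro x
    have hzero : f xb ≤ f x := by
      have hL : LipBound (fun _ : X => (0 : ℝ)) ε := fun x₁ x₂ => by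
        simpa using by positivity
      simpa using (hsub _ h0Φ hL).2 x
    have hle : ∀ φ ∈ Φ, LipBound φ ε → f xb + ((φ x - φ xb : ℝ) : EReal) ≤ f x :=
      fun φ hφ hL => (hsub φ hφ hL).2 x
    lift f xb to ℝ using ⟨hf_top, hf_bot⟩ with a
    induction hfx : f x with
    | top => exact le_top
    | bot => simp [hfx] at hzero
    | coe b =>
      simp only [hfx, ← EReal.coe_add, EReal.coe_le_coe_iff] at hle ⊢
      have := hsd.div_mul_dist_le hκ hε h0Φ (x := x) (y := xb) (b := b - a)
        fun φ hφ hL => by linarith [hle φ hφ hL]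
      linarith
  have hrate := le_descentRate hf_top hf_bot growth
  exact ⟨growth, hrate, (EReal.coe_pos.2 (div_pos hε hκ)).trans_le hrate⟩
end

section
/- Let 𝕏 be a real Banach space and f : 𝕏 → ℝ ∪ {+∞} a lower semicontinuous function bounded from below. If there exists σ > 0 such that sup { inf_{‖u‖ = 1} f^H(x; u) : x ∈ 𝕏, f(x) finite, f(x) > inf_𝕏 f } < −σ, then f attains its global minimum, i.e. Argmin(f) ≠ ∅. -/
open Filter Metric Set Topology
open scoped ENNReal RealInnerProductSpace

noncomputable section

/-- The Hadamard lower derivative `f^H(xb;u) = liminf_{v→u, t↓0} (f(xb+tv) − f xb)/t`. -/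
def hadamardLower {E : Type*} [NormedAddCommGroup E] [NormedSpace ℝ E]
    (f : E → EReal) (xb u : E) : EReal :=
  Filter.liminf (fun p : ℝ × E => (f (xb + p.1 • p.2) - f xb) * (((p.1)⁻¹ : ℝ) : EReal))
    ((𝓝[Set.Ioi (0:ℝ)] (0:ℝ)) ×ˢ 𝓝 u)

end

/-- One step of the iteration behind Ekeland's variational principle: among the points whose value
drops by at least `σ` times the distance from `x`, pick one that nearly minimizes `f`. -/
theorem exists_near_minimal_descent {X : Type*} [PseudoMetricSpace X] {D : Set X} {f : X → ℝ}
    {m σ ε : ℝ} (hm : ∀ x ∈ D, m ≤ f x) (hε : 0 < ε) {x : X} (hx : x ∈ D) :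
    ∃ y ∈ D, f y + σ * dist x y ≤ f x ∧
      ∀ z ∈ D, f z + σ * dist x z ≤ f x → f y ≤ f z + ε := by
  set S : Set X := {y | y ∈ D ∧ f y + σ * dist x y ≤ f x}
  have hne : (f '' S).Nonempty := ⟨f x, x, ⟨hx, by simp⟩, rfl⟩
  have hbdd : BddBelow (f '' S) := ⟨m, by rintro _ ⟨y, hy, rfl⟩; exact hm y hy.1⟩
  obtain ⟨_, ⟨y, hy, rfl⟩, hlt⟩ := Real.lt_sInf_add_pos hne hε
  refine ⟨y, hy.1, hy.2, fun z hz hzx => ?_⟩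
  have := csInf_le hbdd ⟨z, ⟨hz, hzx⟩, rfl⟩
  linarith

/-- **Ekeland's variational principle** for a real function that is bounded below on a nonempty
subset `D` of a complete metric space and whose epigraph over `D` is sequentially closed. -/
theorem exists_ekeland_point_on {X : Type*} [PseudoMetricSpace X] [CompleteSpace X] {D : Set X}
    {f : X → ℝ} {m σ : ℝ} (hD : D.Nonempty) (hm : ∀ x ∈ D, m ≤ f x) (hσ : 0 < σ)
    (hclosed : ∀ (u : ℕ → X) (z : X) (L : ℝ), (∀ n, u n ∈ D) → Tendsto u atTop (𝓝 z) →
      Tendsto (fun n => f (u n)) atTop (𝓝 L) → z ∈ D ∧ f z ≤ L) :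
    ∃ x ∈ D, ∀ y ∈ D, f x ≤ f y + σ * dist x y := by
  have step : ∀ (n : ℕ) (x : D), ∃ y : D, f y + σ * dist (x : X) y ≤ f x ∧
      ∀ z ∈ D, f z + σ * dist (x : X) z ≤ f x → f y ≤ f z + 1 / ((n : ℝ) + 1) := by
    rintro n ⟨x, hx⟩
    obtain ⟨y, hy, h⟩ :=
      exists_near_minimal_descent (σ := σ) hm (Nat.one_div_pos_of_nat (n := n)) hx
    exact ⟨⟨y, hy⟩, h⟩
  choose next hdesc hmin using step
  obtain ⟨x₀, hx₀⟩ := hD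
  let w : ℕ → D := fun n => Nat.rec ⟨x₀, hx₀⟩ next n
  let u : ℕ → X := fun n => (w n).1
  have hu : ∀ n, u n ∈ D := fun n => (w n).2
  have hchain : ∀ n k, n ≤ k → f (u k) + σ * dist (u n) (u k) ≤ f (u n) := by
    intro n k hnk
    induction k, hnk using Nat.le_induction with
    | base => simp
    | succ k _ ih =>
      have h₁ : f (u (k + 1)) + σ * dist (u k) (u (k + 1)) ≤ f (u k) := hdesc k (w k)
      have h₂ := mul_le_mul_of_nonneg_left (dist_triangle (u n) (u k) (u (k + 1))) hσ.le
      linarith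
  have hanti : Antitone fun n => f (u n) := fun n k hnk => by
    have := hchain n k hnk
    have := mul_nonneg hσ.le (dist_nonneg (x := u n) (y := u k))
    simp only
    linarith
  obtain ⟨L, hL⟩ : ∃ L, Tendsto (fun n => f (u n)) atTop (𝓝 L) :=
    ⟨_, tendsto_atTop_ciInf hanti ⟨m, by rintro _ ⟨n, rfl⟩; exact hm _ (hu n)⟩⟩
  have hcauchy : CauchySeq u := by
    refine cauchySeq_of_le_tendsto_0' (fun n => (f (u n) - L) / σ) (fun n k hnk => ?_) ?_
    · rw [le_div_iff₀ hσ]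
      have := hchain n k hnk
      have := hanti.le_of_tendsto hL k
      linarith
    · simpa using (hL.sub_const L).div_const σ
  obtain ⟨z, hz⟩ := cauchySeq_tendsto_of_complete hcauchy
  obtain ⟨hzD, hzL⟩ := hclosed u z L hu hz hL
  have hzn : ∀ n, L + σ * dist (u n) z ≤ f (u n) := fun n =>
    le_of_tendsto (hL.add ((tendsto_const_nhds.dist hz).const_mul σ))
      ((eventually_ge_atTop n).mono (hchain n))
  refine ⟨z, hzD, fun y hy => ?_⟩
  by_contra! hlt
  have hLy : L ≤ f y := by
    have hlim : Tendsto (fun n : ℕ => f y + 1 / ((n : ℝ) + 1)) atTop (𝓝 (f y)) := by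
      simpa using tendsto_one_div_add_atTop_nhds_zero_nat.const_add (f y)
    refine le_of_tendsto_of_tendsto' ((tendsto_add_atTop_iff_nat 1).2 hL) hlim fun n => ?_
    refine hmin n (w n) y hy ?_
    have h₁ := mul_le_mul_of_nonneg_left (dist_triangle (u n) z y) hσ.le
    have h₂ := hzn n
    change f y + σ * dist (u n) y ≤ f (u n)
    linarith
  have := mul_nonneg hσ.le (dist_nonneg (x := z) (y := y))
  linarith

/-- **Ekeland's variational principle** for a lower semicontinuous extended-real-valued function
that is bounded below and not identically `⊤`. -/
theorem LowerSemicontinuous.exists_ekeland_point {X : Type*} [PseudoMetricSpace X]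
    [CompleteSpace X] {f : X → EReal} (hf : LowerSemicontinuous f) {m σ : ℝ}
    (hm : ∀ x, (m : EReal) ≤ f x) (hσ : 0 < σ) (hdom : ∃ x, f x ≠ ⊤) :
    ∃ x, f x ≠ ⊤ ∧ ∀ y, f y ≠ ⊤ → (f x).toReal ≤ (f y).toReal + σ * dist x y := by
  have hbot : ∀ x, f x ≠ ⊥ := fun x => ((EReal.bot_lt_coe m).trans_le (hm x)).ne'
  refine exists_ekeland_point_on (D := {x | f x ≠ ⊤}) (m := m) hdom
    (fun x hx => ?_) hσ fun u z L hu hz hL => ?_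
  · exact EReal.coe_le_coe_iff.1 ((hm x).trans (EReal.coe_toReal hx (hbot x)).ge)
  · have hzL : f z ≤ L := by
      refine le_of_forall_lt fun a ha => ?_
      obtain ⟨b, hab, hb⟩ := exists_between ha
      have hev : ∀ᶠ n in atTop, b ≤ ((f (u n)).toReal : EReal) := by
        filter_upwards [hz.eventually (hf z b hb)] with n hn
        exact hn.le.trans (EReal.coe_toReal (hu n) (hbot _)).ge
      exact hab.trans_le (ge_of_tendsto ((continuous_coe_real_ereal.tendsto L).comp hL) hev)
    have hzD : f z ≠ ⊤ := (hzL.trans_lt (EReal.coe_lt_top L)).ne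
    exact ⟨hzD, EReal.coe_le_coe_iff.1 ((EReal.coe_toReal hzD (hbot z)).le.trans hzL)⟩

/-- A negative bound on the Hadamard lower derivative in a unit direction yields a point
whose value is lower than `f x` at any smaller rate `c`. -/
theorem exists_lt_of_hadamardLower_lt {E : Type*} [NormedAddCommGroup E] [NormedSpace ℝ E]
    {f : E → EReal} (hbot : ∀ x, f x ≠ ⊥) {x u : E} (hx : f x ≠ ⊤) (hu : ‖u‖ = 1) {c σ : ℝ}
    (hcσ : c < σ) (h : hadamardLower f x u < ((-σ : ℝ) : EReal)) :
    ∃ y, f y ≠ ⊤ ∧ (f y).toReal + c * dist x y < (f x).toReal := by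
  have hfreq := Filter.frequently_lt_of_liminf_lt (by isBoundedDefault) h
  have hpos : ∀ᶠ p : ℝ × E in 𝓝[Set.Ioi (0 : ℝ)] (0 : ℝ) ×ˢ 𝓝 u, 0 < p.1 :=
    tendsto_fst.eventually self_mem_nhdsWithin
  have hnorm : ∀ᶠ p : ℝ × E in 𝓝[Set.Ioi (0 : ℝ)] (0 : ℝ) ×ˢ 𝓝 u, c * ‖p.2‖ < σ := by
    refine tendsto_snd.eventually ((continuous_const.mul continuous_norm).continuousAt.eventually_lt
      continuousAt_const ?_)
    simpa [hu] using hcσ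
  obtain ⟨⟨t, v⟩, hlt, ht, hv⟩ := (hfreq.and_eventually (hpos.and hnorm)).exists
  simp only at hlt ht hv
  have hxr := EReal.coe_toReal hx (hbot x)
  have hy : f (x + t • v) ≠ ⊤ := by
    intro hy
    rw [hy, ← hxr, EReal.top_sub_coe, EReal.top_mul_coe_of_pos (inv_pos.2 ht)] at hlt
    exact not_top_lt hlt
  refine ⟨x + t • v, hy, ?_⟩
  have hyr := EReal.coe_toReal hy (hbot _)
  rw [← hxr, ← hyr, ← EReal.coe_sub, ← EReal.coe_mul, EReal.coe_lt_coe_iff, ← div_eq_mul_inv,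
    div_lt_iff₀ ht] at hlt
  have hd : dist x (x + t • v) = t * ‖v‖ := by
    rw [dist_self_add_right, norm_smul, Real.norm_of_nonneg ht.le]
  rw [hd]
  nlinarith [mul_lt_mul_of_pos_left hv ht]

/-- on a Banach space, if `f` is l.s.c., bounded below and
`sup { inf_{‖u‖=1} f^H(x;u) : f x finite, f x > inf f } < −σ` for some `σ > 0`, then
`Argmin f ≠ ∅`. -/
theorem argmin_nonempty_of_hadamardLower_lt_neg {E : Type*} [NormedAddCommGroup E]
    [NormedSpace ℝ E] [CompleteSpace E]
    (f : E → EReal) (hbot : ∀ x, f x ≠ ⊥) (hlsc : LowerSemicontinuous f)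
    (m : ℝ) (hm : ∀ x, (m : EReal) ≤ f x) (σ : ℝ) (hσ : 0 < σ)
    (hsup : sSup {y : EReal | ∃ x : E, f x ≠ ⊤ ∧ (⨅ z, f z) < f x ∧
      y = ⨅ u ∈ {u : E | ‖u‖ = 1}, hadamardLower f x u} < ((-σ : ℝ) : EReal)) :
    {x : E | f x ≤ ⨅ z, f z}.Nonempty := by
  by_contra hempty
  have hlt : ∀ x, (⨅ z, f z) < f x := fun x => not_le.1 fun hx => hempty ⟨x, hx⟩
  have hdom : ∃ x, f x ≠ ⊤ := by
    by_contra! htop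
    exact hempty ⟨0, by simp [htop]⟩
  obtain ⟨x, hx, hmin⟩ := hlsc.exists_ekeland_point hm (half_pos hσ) hdom
  have hinf : (⨅ u ∈ {u : E | ‖u‖ = 1}, hadamardLower f x u) < ((-σ : ℝ) : EReal) :=
    lt_of_le_of_lt (le_sSup (by exact ⟨x, hx, hlt x, rfl⟩)) hsup
  obtain ⟨u, hu, hlow⟩ : ∃ u : E, ‖u‖ = 1 ∧ hadamardLower f x u < ((-σ : ℝ) : EReal) := by
    simpa only [iInf_lt_iff, exists_prop, mem_ofPred_eq] using hinf
  obtain ⟨y, hy, hyx⟩ :=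
    exists_lt_of_hadamardLower_lt hbot hx hu (half_lt_self hσ) hlow
  exact hyx.not_ge (hmin y hy)
end

section
/- Let 𝕏 be a real Banach space and f : 𝕏 → ℝ ∪ {+∞} a lower semicontinuous convex function which is continuous at a point x̄ with f(x̄) finite. Then the steepest descent rate satisfies f↓(x̄) > 0 if and only if 0* lies in the norm interior of the convex-analysis subdifferential ∂f(x̄) in 𝕏*. -/
open Filter Metric Set Topology
open scoped ENNReal RealInnerProductSpace

theorem coe_le_sub_mul_inv_iff {b c d : ℝ} (hd : 0 < d) (a : EReal) (ha : a ≠ ⊥) :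
    (c : EReal) ≤ (a - b) * ((d⁻¹ : ℝ) : EReal) ↔ (b : EReal) + ((c * d : ℝ) : EReal) ≤ a := by
  have hd' : 0 < d⁻¹ := inv_pos.mpr hd
  induction a with
  | bot => exact absurd rfl ha
  | top => simp [EReal.top_mul_coe_of_pos hd']
  | coe a =>
    norm_cast
    rw [← div_eq_mul_inv, le_div_iff₀ hd]
    constructor <;> intro h <;> linarith

/-- A convex function that grows at least linearly near `xb` does so globally. -/
theorem add_mul_norm_le_of_eventually {E : Type*} [NormedAddCommGroup E] [NormedSpace ℝ E]
    {f : E → EReal} (hbot : ∀ x, f x ≠ ⊥)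
    (hconv : ∀ x y : E, ∀ t : ℝ, 0 ≤ t → t ≤ 1 →
      f (t • x + (1 - t) • y) ≤ (t : EReal) * f x + ((1 - t : ℝ) : EReal) * f y)
    {xb : E} {b c : ℝ} (hb : f xb = b)
    (h : ∀ᶠ x in 𝓝 xb, (b : EReal) + ((c * ‖x - xb‖ : ℝ) : EReal) ≤ f x) (x : E) :
    (b : EReal) + ((c * ‖x - xb‖ : ℝ) : EReal) ≤ f x := by
  have hcont : Continuous fun t : ℝ => t • x + (1 - t) • xb := by fun_prop
  have hlim : Tendsto (fun t : ℝ => t • x + (1 - t) • xb) (𝓝[>] 0) (𝓝 xb) := by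
    have := hcont.tendsto 0
    simp only [zero_smul, sub_zero, one_smul, zero_add] at this
    exact this.mono_left nhdsWithin_le_nhds
  obtain ⟨t, ht, ht0, ht1⟩ :=
    ((hlim.eventually h).and (Ioo_mem_nhdsGT (zero_lt_one' ℝ))).exists
  have hseg := ht.trans (hconv x xb t ht0.le ht1.le)
  have hnorm : ‖t • x + (1 - t) • xb - xb‖ = t * ‖x - xb‖ := by
    rw [show t • x + (1 - t) • xb - xb = t • (x - xb) by module, norm_smul,
      Real.norm_of_nonneg ht0.le]
  rw [hnorm, hb] at hseg
  have hx := hbot x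
  generalize f x = a at hseg hx ⊢
  induction a with
  | bot => exact absurd rfl hx
  | top => exact le_top
  | coe a =>
    norm_cast at hseg ⊢
    refine le_of_mul_le_mul_left ?_ ht0
    linarith

/-- on a Banach space, for a l.s.c. convex `f : E → ℝ ∪ {+∞}` continuous at
`xb` with `f xb` finite, `f↓(xb) > 0` iff `0*` lies in the norm interior of the
convex-analysis subdifferential `∂f(xb) ⊆ E*`. -/
theorem positive_descentRate_iff_zero_mem_interior_convexSubdiff {E : Type*}
    [NormedAddCommGroup E] [NormedSpace ℝ E] [CompleteSpace E]
    (f : E → EReal) (hbot : ∀ x, f x ≠ ⊥) (hlsc : LowerSemicontinuous f)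
    (hconv : ∀ x y : E, ∀ t : ℝ, 0 ≤ t → t ≤ 1 →
      f (t • x + (1 - t) • y) ≤ (t : EReal) * f x + ((1 - t : ℝ) : EReal) * f y)
    (xb : E) (hfin : f xb ≠ ⊤) (hcont : ContinuousAt f xb) :
    0 < descentRate f xb ↔
      (0 : E →L[ℝ] ℝ) ∈
        interior {p : E →L[ℝ] ℝ | ∀ x, f xb + ((p (x - xb) : ℝ) : EReal) ≤ f x} := by
  obtain ⟨b, hb⟩ : ∃ b : ℝ, f xb = b := ⟨_, (EReal.coe_toReal hfin (hbot xb)).symm⟩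
  rw [descentRate, hb, mem_interior_iff_mem_nhds, Metric.mem_nhds_iff]
  constructor
  · intro h
    obtain ⟨c, hc0, hc⟩ := EReal.lt_iff_exists_real_btwn.mp h
    have hc0 : 0 < c := by exact_mod_cast hc0
    have hloc : ∀ᶠ x in 𝓝 xb, (b : EReal) + ((c * ‖x - xb‖ : ℝ) : EReal) ≤ f x := by
      filter_upwards [eventually_nhdsWithin_iff.mp (eventually_lt_of_lt_liminf hc)] with x hx
      rcases eq_or_ne x xb with rfl | hne
      · simp [hb]
      · rw [← dist_eq_norm]
        exact (coe_le_sub_mul_inv_iff (dist_pos.mpr hne) _ (hbot x)).mp (hx hne).le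
    refine ⟨c, hc0, fun p hp x => le_trans ?_ (add_mul_norm_le_of_eventually hbot hconv hb hloc x)⟩
    have hpc : ‖p‖ ≤ c := (mem_ball_zero_iff.mp hp).le
    gcongr
    exact (le_abs_self _).trans (p.le_of_opNorm_le hpc _)
  · rintro ⟨ε, hε, hsub⟩
    have hε2 : 0 < ε / 2 := half_pos hε
    refine lt_of_lt_of_le (b := ((ε / 2 : ℝ) : EReal)) (by exact_mod_cast hε2) ?_
    refine le_liminf_of_le (by isBoundedDefault) ?_
    filter_upwards [self_mem_nhdsWithin] with x hx
    refine (coe_le_sub_mul_inv_iff (dist_pos.mpr hx) _ (hbot x)).mpr ?_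
    obtain ⟨g, hg, hgx⟩ := exists_dual_vector'' ℝ (x - xb)
    have hgx' : g (x - xb) = ‖x - xb‖ := by simpa using hgx
    have hmem : (ε / 2) • g ∈ ball (0 : E →L[ℝ] ℝ) ε := by
      rw [mem_ball_zero_iff, norm_smul, Real.norm_of_nonneg hε2.le]
      nlinarith
    simpa [hgx', dist_eq_norm] using hsub hmem x
end

section
/- Let 𝕏 be a real Banach space and f : 𝕏 → ℝ ∪ {+∞} a lower semicontinuous convex function, continuous at x̄ with f(x̄) = 0. If 0* lies in the norm interior of ∂f(x̄), then: (i) x̄ is a global sharp minimizer of f, i.e. there is σ > 0 with f(x) ≥ σ‖x − x̄‖ for all x ∈ 𝕏; (ii) x̄ is superstable, i.e. there exists ε₀ > 0 such that x̄ is a local minimizer of f + g for every g : 𝕏 → ℝ ∪ {±∞} with g(x̄) finite and strong slope |∇g|(x̄) < ε₀; (iii) f admits a global error bound at x̄, i.e. there is c > 0 with dist(x, {y : f(y) ≤ 0}) ≤ c·max{f(x), 0} for all x ∈ 𝕏; (iv) there exists ε > 0 such that every f̃ : 𝕏 → ℝ ∪ {±∞} with f̃(x̄) = 0 and limsup_{x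 → x̄} |f̃(x) − f(x)|/‖x − x̄‖ ≤ ε admits a local error bound at x̄. -/
open Filter Metric Set Topology
open scoped ENNReal RealInnerProductSpace

theorem EReal.le_coe_mul_add_of_sub_mul_inv_lt {a b : EReal} {s d : ℝ} (hd : 0 < d)
    (h : (a - b) * ((d⁻¹ : ℝ) : EReal) < (s : EReal)) : a ≤ ((s * d : ℝ) : EReal) + b := by
  have hd' : 0 < d⁻¹ := inv_pos.mpr hd
  induction a with
  | bot => exact bot_le
  | top =>
    induction b with
    | top => exact le_top.trans_eq (EReal.coe_add_top _).symm
    | bot => simp [EReal.top_mul_coe_of_pos hd'] at h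
    | coe b => simp [EReal.top_mul_coe_of_pos hd'] at h
  | coe a =>
    induction b with
    | top => exact le_top.trans_eq (EReal.coe_add_top _).symm
    | bot => simp [EReal.top_mul_coe_of_pos hd'] at h
    | coe b =>
      norm_cast at h ⊢
      rw [← div_eq_mul_inv, div_lt_iff₀ hd] at h
      linarith

theorem EReal.infEDist_le_of_mul_dist_le {X : Type*} [MetricSpace X] {h : X → EReal} {x xb : X}
    {s : ℝ} (hs : 0 < s) (hxb : h xb ≤ 0) (hx : ((s * dist x xb : ℝ) : EReal) ≤ h x) :
    (Metric.infEDist x {y | h y ≤ 0} : EReal) ≤ ((s⁻¹ : ℝ) : EReal) * max (h x) 0 := by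
  have hmem : xb ∈ {y | h y ≤ 0} := hxb
  have h1 : (Metric.infEDist x {y | h y ≤ 0} : EReal) ≤ ((dist x xb : ℝ) : EReal) := by
    refine (EReal.coe_ennreal_le_coe_ennreal_iff.mpr
      (Metric.infEDist_le_edist_of_mem hmem)).trans ?_
    rw [edist_dist, EReal.coe_ennreal_ofReal, max_eq_left dist_nonneg]
  have h2 : ((dist x xb : ℝ) : EReal) = ((s⁻¹ : ℝ) : EReal) * ((s * dist x xb : ℝ) : EReal) := by
    rw [← EReal.coe_mul, inv_mul_cancel_left₀ hs.ne']
  refine h1.trans (h2.le.trans ?_)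
  exact mul_le_mul_of_nonneg_left (hx.trans (le_max_left _ _))
    (EReal.coe_nonneg.mpr (inv_nonneg.mpr hs.le))

theorem exists_forall_mul_dist_le_of_zero_mem_interior {E : Type*}
    [NormedAddCommGroup E] [NormedSpace ℝ E] {f : E → EReal} {xb : E} (h0 : f xb = 0)
    (hint : (0 : E →L[ℝ] ℝ) ∈
      interior {p : E →L[ℝ] ℝ | ∀ x, f xb + ((p (x - xb) : ℝ) : EReal) ≤ f x}) :
    ∃ σ : ℝ, 0 < σ ∧ ∀ x : E, ((σ * dist x xb : ℝ) : EReal) ≤ f x := by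
  obtain ⟨δ, hδ, hball⟩ := Metric.mem_nhds_iff.mp (mem_interior_iff_mem_nhds.mp hint)
  refine ⟨δ / 2, half_pos hδ, fun x => ?_⟩
  obtain ⟨p, hp1, hp⟩ := exists_dual_vector'' ℝ (x - xb)
  have hmem : (δ / 2) • p ∈ ball (0 : E →L[ℝ] ℝ) δ := by
    rw [mem_ball_zero_iff, norm_smul, Real.norm_of_nonneg (half_pos hδ).le]
    nlinarith
  have hx := hball hmem x
  have hpx : p (x - xb) = ‖x - xb‖ := by simpa using hp
  rwa [h0, zero_add, smul_apply, hpx, smul_eq_mul, ← dist_eq_norm] at hx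

/-- on a Banach space, for a l.s.c. convex `f` continuous at `xb` with
`f xb = 0`, if `0*` lies in the norm interior of `∂f(xb)` then: (i) `xb` is a global
sharp minimizer; (ii) `xb` is superstable; (iii) `f` admits a global error bound at `xb`;
(iv) every sufficiently small perturbation `ft` of `f` admits a local error bound at `xb`. -/
theorem benefits_of_zero_mem_interior_convexSubdiff {E : Type*}
    [NormedAddCommGroup E] [NormedSpace ℝ E] [CompleteSpace E]
    (f : E → EReal) (hbot : ∀ x, f x ≠ ⊥) (hlsc : LowerSemicontinuous f)
    (hconv : ∀ x y : E, ∀ t : ℝ, 0 ≤ t → t ≤ 1 →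
      f (t • x + (1 - t) • y) ≤ (t : EReal) * f x + ((1 - t : ℝ) : EReal) * f y)
    (xb : E) (hcont : ContinuousAt f xb) (h0 : f xb = 0)
    (hint : (0 : E →L[ℝ] ℝ) ∈
      interior {p : E →L[ℝ] ℝ | ∀ x, f xb + ((p (x - xb) : ℝ) : EReal) ≤ f x}) :
    (∃ σ : ℝ, 0 < σ ∧ ∀ x : E, ((σ * dist x xb : ℝ) : EReal) ≤ f x) ∧
    (∃ ε₀ : ℝ, 0 < ε₀ ∧ ∀ g : E → EReal, g xb ≠ ⊤ → g xb ≠ ⊥ →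
      strongSlope g xb < (ε₀ : EReal) →
      ∃ r : ℝ, 0 < r ∧ ∀ x ∈ ball xb r, f xb + g xb ≤ f x + g x) ∧
    (∃ c : ℝ, 0 < c ∧ ∀ x : E,
      (EMetric.infEdist x {y | f y ≤ 0} : EReal) ≤ (c : EReal) * max (f x) 0) ∧
    (∃ ε : ℝ, 0 < ε ∧ ∀ ft : E → EReal, ft xb = 0 →
      Filter.limsup
        (fun x => max (ft x - f x) (f x - ft x) * (((dist x xb)⁻¹ : ℝ) : EReal)) (𝓝[≠] xb)
        ≤ (ε : EReal) →
      HasLocalErrorBound ft xb) := by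
  obtain ⟨σ, hσ, hf⟩ := exists_forall_mul_dist_le_of_zero_mem_interior h0 hint
  have hf0 : ∀ x, 0 ≤ f x := fun x =>
    (EReal.coe_nonneg.mpr (mul_nonneg hσ.le dist_nonneg)).trans (hf x)
  refine ⟨⟨σ, hσ, hf⟩, ⟨σ, hσ, fun g _ _ hg => ?_⟩,
    ⟨σ⁻¹, inv_pos.mpr hσ, fun x => EReal.infEDist_le_of_mul_dist_le hσ h0.le (hf x)⟩,
    ⟨σ / 4, by positivity, fun ft hft hlim => ?_⟩⟩
  · rw [h0, zero_add]
    suffices H : ∀ᶠ x in 𝓝 xb, g xb ≤ f x + g x from Metric.eventually_nhds_iff_ball.mp H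
    unfold strongSlope at hg
    split_ifs at hg with hmin
    · filter_upwards [hmin] with x hx
      simpa using add_le_add (hf0 x) hx
    · filter_upwards [eventually_nhdsWithin_iff.mp (eventually_lt_of_limsup_lt hg)] with x hx
      rcases eq_or_ne x xb with rfl | hne
      · simp [h0]
      · exact (EReal.le_coe_mul_add_of_sub_mul_inv_lt (dist_pos.mpr hne) (hx hne)).trans
          (add_le_add_left (hf x) _)
  · have hlt := eventually_lt_of_limsup_lt
      (hlim.trans_lt (EReal.coe_lt_coe_iff.mpr (by linarith : σ / 4 < σ / 2)))
    obtain ⟨r, hr, hball⟩ :=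
      Metric.eventually_nhds_iff_ball.mp (eventually_nhdsWithin_iff.mp hlt)
    refine ⟨(σ / 2)⁻¹, by positivity, r, hr, fun x hx =>
      EReal.infEDist_le_of_mul_dist_le (half_pos hσ) hft.le ?_⟩
    rcases eq_or_ne x xb with rfl | hne
    · simp [hft]
    · have hd := dist_pos.mpr hne
      have hle : (f x - ft x) * (((dist x xb)⁻¹ : ℝ) : EReal) < ((σ / 2 : ℝ) : EReal) :=
        (mul_le_mul_of_nonneg_right (le_max_right _ _)
          (EReal.coe_nonneg.mpr (inv_nonneg.mpr hd.le))).trans_lt (hball x hx hne)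
      have key := (hf x).trans (EReal.le_coe_mul_add_of_sub_mul_inv_lt hd hle)
      generalize ft x = b at key ⊢
      induction b with
      | top => exact le_top
      | bot =>
        rw [EReal.add_bot] at key
        exact absurd (le_bot_iff.mp key) (EReal.coe_ne_bot _)
      | coe b =>
        norm_cast at key ⊢
        linarith
end

section
/- Let f : ℝⁿ → ℝ ∪ {±∞} and let x̄ be a point with f(x̄) finite. Then the steepest descent rate satisfies f↓(x̄) > 0 if and only if 0 lies in the interior of the Fréchet (regular) subdifferential ∂̂f(x̄). -/
open Filter Metric Set Topology
open scoped ENNReal RealInnerProductSpace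

/-- A lower bound on a difference quotient of an extended-real-valued function, cleared of its
denominator. -/
lemma coe_le_sub_sub_mul_inv_iff {a s c d : ℝ} (hd : 0 < d) (y : EReal) :
    (c : EReal) ≤ (y - (a : EReal) - (s : EReal)) * ((d⁻¹ : ℝ) : EReal) ↔
      ((c * d + s + a : ℝ) : EReal) ≤ y := by
  have hd' : 0 < d⁻¹ := inv_pos.mpr hd
  induction y using EReal.rec with
  | bot =>
    simp only [EReal.bot_sub, EReal.bot_mul_coe_of_pos hd', le_bot_iff, EReal.coe_ne_bot]
  | top =>
    simp only [EReal.top_sub_coe, EReal.top_mul_coe_of_pos hd', le_top]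
  | coe y =>
    norm_cast
    rw [← div_eq_mul_inv, le_div_iff₀ hd]
    constructor <;> intro h <;> linarith

/-- A closed ball around `0` contains finitely many vectors that detect, up to the factor `2`,
the norm of every vector. -/
lemma exists_finite_norming_set {E : Type*} [NormedAddCommGroup E] [InnerProductSpace ℝ E]
    [FiniteDimensional ℝ E] {ε : ℝ} (hε : 0 < ε) :
    ∃ t : Set E, t ⊆ closedBall 0 ε ∧ t.Finite ∧
      ∀ h : E, h ≠ 0 → ∃ v ∈ t, ε / 2 * ‖h‖ ≤ ⟪v, h⟫ := by
  have : ProperSpace E := FiniteDimensional.proper ℝ E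
  obtain ⟨t, hts, htf, hcov⟩ :=
    (isCompact_closedBall (0 : E) ε).finite_cover_balls (half_pos hε)
  refine ⟨t, hts, htf, fun h hh => ?_⟩
  have hpos : 0 < ‖h‖ := norm_pos_iff.mpr hh
  set w : E := (ε / ‖h‖) • h with hw
  have hwmem : w ∈ closedBall (0 : E) ε := by
    rw [mem_closedBall_zero_iff, hw, norm_smul, Real.norm_of_nonneg (by positivity),
      div_mul_cancel₀ _ hpos.ne']
  obtain ⟨v, hv, hwv⟩ := mem_iUnion₂.mp (hcov hwmem)
  refine ⟨v, hv, ?_⟩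
  have hinner : ⟪w, h⟫ = ε * ‖h‖ := by
    rw [hw, real_inner_smul_left, real_inner_self_eq_norm_sq]
    field_simp
  have hdiff : ⟪w - v, h⟫ ≤ ε / 2 * ‖h‖ :=
    (real_inner_le_norm _ _).trans <|
      mul_le_mul_of_nonneg_right (mem_ball_iff_norm.mp hwv).le hpos.le
  rw [inner_sub_left, hinner] at hdiff
  linarith

/-- for `f : ℝⁿ → ℝ ∪ {±∞}` with `f xb` finite, `f↓(xb) > 0` iff `0` lies
in the interior of the Fréchet (regular) subdifferential `∂̂f(xb)`. -/
theorem positive_descentRate_iff_zero_mem_interior_regularSubdiff (n : ℕ)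
    (f : EuclideanSpace ℝ (Fin n) → EReal) (xb : EuclideanSpace ℝ (Fin n))
    (hf_top : f xb ≠ ⊤) (hf_bot : f xb ≠ ⊥) :
    0 < descentRate f xb ↔
      (0 : EuclideanSpace ℝ (Fin n)) ∈ interior {v : EuclideanSpace ℝ (Fin n) |
        0 ≤ Filter.liminf
          (fun x => (f x - f xb - ((⟪v, x - xb⟫ : ℝ) : EReal)) * (((dist x xb)⁻¹ : ℝ) : EReal))
          (𝓝[≠] xb)} := by
  lift f xb to ℝ using ⟨hf_top, hf_bot⟩ with a ha
  unfold descentRate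
  rw [← ha]
  have hne : ∀ᶠ x in 𝓝[≠] xb, x ≠ xb := eventually_mem_nhdsWithin
  constructor
  · intro hpos
    obtain ⟨c, hc0, hc⟩ := EReal.lt_iff_exists_real_btwn.mp hpos
    have hc0 : 0 < c := EReal.coe_pos.mp hc0
    rw [mem_interior_iff_mem_nhds]
    filter_upwards [ball_mem_nhds (0 : EuclideanSpace ℝ (Fin n)) hc0] with v hv
    refine le_liminf_of_le (by isBoundedDefault) ?_
    filter_upwards [eventually_lt_of_lt_liminf hc, hne] with x hx hxne
    have hd : 0 < dist x xb := dist_pos.mpr hxne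
    have hx' := (coe_le_sub_sub_mul_inv_iff (s := 0) hd (f x)).mp (by simpa using hx.le)
    refine (coe_le_sub_sub_mul_inv_iff (c := 0) hd (f x)).mpr (le_trans ?_ hx')
    have hinner : ⟪v, x - xb⟫ ≤ c * dist x xb := by
      rw [dist_eq_norm]
      exact (real_inner_le_norm _ _).trans <|
        mul_le_mul_of_nonneg_right (mem_ball_zero_iff.mp hv).le (norm_nonneg _)
    exact EReal.coe_le_coe_iff.mpr (by linarith)
  · intro hint
    obtain ⟨ε, hε, hsub⟩ :=
      nhds_basis_closedBall.mem_iff.mp (mem_interior_iff_mem_nhds.mp hint)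
    obtain ⟨t, hts, htf, ht⟩ :=
      exists_finite_norming_set (E := EuclideanSpace ℝ (Fin n)) hε
    have hquot : ∀ᶠ x in 𝓝[≠] xb, ∀ v ∈ t, ((-(ε / 4) : ℝ) : EReal) <
        (f x - a - ((⟪v, x - xb⟫ : ℝ) : EReal)) * (((dist x xb)⁻¹ : ℝ) : EReal) := by
      refine (eventually_all_finite htf).mpr fun v hv => eventually_lt_of_lt_liminf ?_
      exact lt_of_lt_of_le (EReal.coe_neg'.mpr (by linarith)) (hsub (hts hv))
    refine lt_of_lt_of_le (EReal.coe_pos.mpr (show 0 < ε / 4 by positivity)) ?_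
    refine le_liminf_of_le (by isBoundedDefault) ?_
    filter_upwards [hquot, hne] with x hx hxne
    have hd : 0 < dist x xb := dist_pos.mpr hxne
    obtain ⟨v, hv, hvx⟩ := ht (x - xb) (sub_ne_zero.mpr hxne)
    rw [← dist_eq_norm] at hvx
    have hfx := (coe_le_sub_sub_mul_inv_iff hd (f x)).mp (hx v hv).le
    have := (coe_le_sub_sub_mul_inv_iff (s := 0) (c := ε / 4) (a := a) hd (f x)).mpr
      (le_trans (EReal.coe_le_coe_iff.mpr (by linarith)) hfx)
    simpa using this
end

section
/- Let f : ℝⁿ → ℝ ∪ {±∞} and x̄ with f(x̄) = 0. If 0 lies in the interior of the Fréchet (regular) subdifferential ∂̂f(x̄), then: (i) x̄ is a local sharp minimizer of f; (ii) x̄ is superstable, i.e. there exists ε₀ > 0 such that x̄ is a local minimizer of f + g for every g : ℝⁿ → ℝ ∪ {±∞} with g(x̄) finite and strong slope |∇g|(x̄) < ε₀; (iii) f admits a local error bound at x̄; (iv) there exists ε > 0 such that every f̃ : ℝⁿ → ℝ ∪ {±∞} with f̃(x̄) = 0 and limsup_{x → x̄} |f̃(x) − f(x)|/‖x − x̄‖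 ≤ ε admits a local error bound at x̄. -/
open Filter Metric Set Topology
open scoped ENNReal RealInnerProductSpace

theorem EReal.coe_le_of_neg_lt_sub_mul_inv {a : EReal} {t η d : ℝ} (hd : 0 < d)
    (h : ((-η : ℝ) : EReal) < (a - (t : EReal)) * ((d⁻¹ : ℝ) : EReal)) :
    ((t - η * d : ℝ) : EReal) ≤ a := by
  induction a with
  | top => exact le_top
  | bot =>
    rw [EReal.bot_sub, EReal.bot_mul_coe_of_pos (inv_pos.2 hd)] at h
    exact absurd h not_lt_bot
  | coe a =>
    norm_cast at h ⊢
    rw [← div_eq_mul_inv, lt_div_iff₀ hd] at h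
    linarith

theorem EReal.sub_coe_le_of_sub_mul_inv_lt {a : ℝ} {b : EReal} {η d : ℝ} (hd : 0 < d)
    (h : ((a : EReal) - b) * ((d⁻¹ : ℝ) : EReal) < (η : EReal)) :
    ((a - η * d : ℝ) : EReal) ≤ b := by
  induction b with
  | top => exact le_top
  | bot =>
    rw [EReal.coe_sub_bot, EReal.top_mul_coe_of_pos (inv_pos.2 hd)] at h
    exact absurd h not_top_lt
  | coe b =>
    norm_cast at h ⊢
    rw [← div_eq_mul_inv, div_lt_iff₀ hd] at h
    linarith

/-- If `0` lies in the interior of the regular subdifferential of `f` at `xb`, then `f` grows at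
least linearly around `xb`. -/
theorem exists_eventually_coe_dist_le_of_zero_mem_interior {E : Type*} [NormedAddCommGroup E]
    [InnerProductSpace ℝ E] [FiniteDimensional ℝ E] {f : E → EReal} {xb : E} (h0 : f xb = 0)
    (hint : (0 : E) ∈ interior {v : E |
      0 ≤ Filter.liminf
        (fun x => (f x - f xb - ((⟪v, x - xb⟫ : ℝ) : EReal)) * (((dist x xb)⁻¹ : ℝ) : EReal))
        (𝓝[≠] xb)}) :
    ∃ σ : ℝ, 0 < σ ∧ ∀ᶠ x in 𝓝 xb, ((σ * dist x xb : ℝ) : EReal) ≤ f x := by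
  obtain ⟨δ, hδ, hball⟩ := Metric.mem_nhds_iff.1 (mem_interior_iff_mem_nhds.1 hint)
  obtain ⟨s, hs, hsδ⟩ := exists_between hδ
  obtain ⟨T, hTs, hTfin, hT⟩ :=
    (isCompact_sphere (0 : E) s).finite_cover_balls (e := s / 4) (by positivity)
  refine ⟨s / 2, by positivity, ?_⟩
  have hev : ∀ᶠ x in 𝓝[≠] xb, ∀ v ∈ T, ((⟪v, x - xb⟫ - s / 4 * dist x xb : ℝ) : EReal) ≤ f x := by
    refine (Filter.eventually_all_finite hTfin).2 fun v hv => ?_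
    have hvs : dist v 0 = s := hTs hv
    have hlim := hball (show v ∈ ball (0 : E) δ from hvs.trans_lt hsδ)
    have hneg : ((-(s / 4) : ℝ) : EReal) < 0 := by
      have : -(s / 4) < 0 := by linarith
      exact_mod_cast this
    filter_upwards [Filter.eventually_lt_of_lt_liminf (hneg.trans_le hlim),
      self_mem_nhdsWithin] with x hx hne
    rw [h0, sub_zero] at hx
    exact EReal.coe_le_of_neg_lt_sub_mul_inv (dist_pos.2 hne) hx
  filter_upwards [eventually_nhdsWithin_iff.1 hev] with x hx
  rcases eq_or_ne x xb with rfl | hne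
  · simp [h0]
  have hd : 0 < ‖x - xb‖ := norm_pos_iff.2 (sub_ne_zero.2 hne)
  have hu : (s / ‖x - xb‖) • (x - xb) ∈ sphere (0 : E) s := by
    rw [mem_sphere_zero_iff_norm, norm_smul, Real.norm_of_nonneg (by positivity)]
    field_simp
  obtain ⟨v, hv, huv⟩ := Set.mem_iUnion₂.1 (hT hu)
  refine le_trans ?_ (hx hne v hv)
  rw [dist_eq_norm]
  have h1 : ⟪(s / ‖x - xb‖) • (x - xb) - v, x - xb⟫ ≤ s / 4 * ‖x - xb‖ := by
    refine (real_inner_le_norm _ _).trans ?_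
    rw [mem_ball, dist_eq_norm] at huv
    gcongr
  rw [inner_sub_left, real_inner_smul_left, real_inner_self_eq_norm_sq] at h1
  have h2 : s / ‖x - xb‖ * ‖x - xb‖ ^ 2 = s * ‖x - xb‖ := by field_simp
  norm_cast
  linarith

theorem hasLocalErrorBound_of_eventually_coe_dist_le {X : Type*} [MetricSpace X] {f : X → EReal}
    {xb : X} (h0 : f xb ≤ 0) {σ : ℝ} (hσ : 0 < σ)
    (h : ∀ᶠ x in 𝓝 xb, ((σ * dist x xb : ℝ) : EReal) ≤ f x) :
    HasLocalErrorBound f xb := by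
  obtain ⟨r, hr, hball⟩ := Metric.eventually_nhds_iff_ball.1 h
  refine ⟨σ⁻¹, inv_pos.2 hσ, r, hr, fun x hx => ?_⟩
  have h1 : (EMetric.infEdist x {y | f y ≤ 0} : EReal) ≤ ((dist x xb : ℝ) : EReal) := by
    refine (EReal.coe_ennreal_le_coe_ennreal_iff.2
      (Metric.infEDist_le_edist_of_mem (x := x) (y := xb) h0)).trans_eq ?_
    rw [edist_dist, EReal.coe_ennreal_ofReal, max_eq_left dist_nonneg]
  have h2 : ((dist x xb : ℝ) : EReal) = ((σ⁻¹ : ℝ) : EReal) * ((σ * dist x xb : ℝ) : EReal) := by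
    rw [← EReal.coe_mul, inv_mul_cancel_left₀ hσ.ne']
  refine h1.trans (h2.trans_le ?_)
  exact mul_le_mul_of_nonneg_left ((hball x hx).trans (le_max_left _ _))
    (by exact_mod_cast (inv_pos.2 hσ).le)

theorem eventually_sub_coe_dist_le_of_strongSlope_lt {X : Type*} [MetricSpace X] {g : X → EReal}
    {xb : X} {ε c : ℝ} (hε : 0 ≤ ε) (hc : g xb = c) (h : strongSlope g xb < (ε : EReal)) :
    ∀ᶠ x in 𝓝 xb, ((c - ε * dist x xb : ℝ) : EReal) ≤ g x := by
  unfold strongSlope at h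
  split_ifs at h with hmin
  · filter_upwards [hmin] with x hx
    refine le_trans ?_ (hc ▸ hx)
    have := mul_nonneg hε (dist_nonneg (x := x) (y := xb))
    exact_mod_cast (by linarith : c - ε * dist x xb ≤ c)
  · filter_upwards [eventually_nhdsWithin_iff.1 (Filter.eventually_lt_of_limsup_lt h)] with x hx
    rcases eq_or_ne x xb with rfl | hne
    · simp [hc]
    · exact EReal.sub_coe_le_of_sub_mul_inv_lt (dist_pos.2 hne) (hc ▸ hx hne)

theorem EReal.coe_le_of_max_sub_mul_inv_lt {a b : EReal} {t η d : ℝ} (hd : 0 < d)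
    (hta : (t : EReal) ≤ a)
    (h : max (b - a) (a - b) * ((d⁻¹ : ℝ) : EReal) < (η : EReal)) :
    ((t - η * d : ℝ) : EReal) ≤ b := by
  have h' : (a - b) * ((d⁻¹ : ℝ) : EReal) < (η : EReal) :=
    (mul_le_mul_of_nonneg_right (le_max_right _ _)
      (by exact_mod_cast (inv_pos.2 hd).le)).trans_lt h
  rcases eq_or_ne b ⊤ with rfl | hb
  · exact le_top
  · refine EReal.sub_coe_le_of_sub_mul_inv_lt hd (lt_of_le_of_lt ?_ h')
    exact mul_le_mul_of_nonneg_right (EReal.sub_le_sub hta le_rfl)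
      (by exact_mod_cast (inv_pos.2 hd).le)

/-- for `f : ℝⁿ → ℝ ∪ {±∞}` with `f xb = 0`, if `0` lies in the interior of
the Fréchet (regular) subdifferential `∂̂f(xb)`, then: (i) `xb` is a local sharp
minimizer; (ii) `xb` is superstable; (iii) `f` admits a local error bound at `xb`;
(iv) every sufficiently small perturbation `ft` of `f` admits a local error bound at `xb`. -/
theorem benefits_of_zero_mem_interior_regularSubdiff (n : ℕ)
    (f : EuclideanSpace ℝ (Fin n) → EReal) (xb : EuclideanSpace ℝ (Fin n))
    (h0 : f xb = 0)
    (hint : (0 : EuclideanSpace ℝ (Fin n)) ∈ interior {v : EuclideanSpace ℝ (Fin n) |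
      0 ≤ Filter.liminf
        (fun x => (f x - f xb - ((⟪v, x - xb⟫ : ℝ) : EReal)) * (((dist x xb)⁻¹ : ℝ) : EReal))
        (𝓝[≠] xb)}) :
    IsLocalSharpMin f xb ∧
    (∃ ε₀ : ℝ, 0 < ε₀ ∧ ∀ g : EuclideanSpace ℝ (Fin n) → EReal, g xb ≠ ⊤ → g xb ≠ ⊥ →
      strongSlope g xb < (ε₀ : EReal) →
      ∃ r : ℝ, 0 < r ∧ ∀ x ∈ ball xb r, f xb + g xb ≤ f x + g x) ∧
    HasLocalErrorBound f xb ∧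
    (∃ ε : ℝ, 0 < ε ∧ ∀ ft : EuclideanSpace ℝ (Fin n) → EReal, ft xb = 0 →
      Filter.limsup
        (fun x => max (ft x - f x) (f x - ft x) * (((dist x xb)⁻¹ : ℝ) : EReal)) (𝓝[≠] xb)
        ≤ (ε : EReal) →
      HasLocalErrorBound ft xb) := by
  obtain ⟨σ, hσ, hf⟩ := exists_eventually_coe_dist_le_of_zero_mem_interior h0 hint
  refine ⟨?_, ⟨σ, hσ, fun g hgt hgb hg => ?_⟩,
    hasLocalErrorBound_of_eventually_coe_dist_le h0.le hσ hf,
    ⟨σ / 4, by positivity, fun ft hft hlim => ?_⟩⟩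
  · obtain ⟨r, hr, hball⟩ := Metric.nhds_basis_closedBall.eventually_iff.1 hf
    exact ⟨σ, hσ, r, hr, fun x hx => by simpa [h0] using hball hx⟩
  · have hc := (EReal.coe_toReal hgt hgb).symm
    obtain ⟨r, hr, hball⟩ := Metric.eventually_nhds_iff_ball.1
      (hf.and (eventually_sub_coe_dist_le_of_strongSlope_lt hσ.le hc hg))
    refine ⟨r, hr, fun x hx => le_trans ?_ (add_le_add (hball x hx).1 (hball x hx).2)⟩
    rw [h0, zero_add, ← EReal.coe_add, add_sub_cancel, ← hc]
  · refine hasLocalErrorBound_of_eventually_coe_dist_le (σ := σ / 2) hft.le (by positivity) ?_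
    have hlt : ((σ / 4 : ℝ) : EReal) < ((σ / 2 : ℝ) : EReal) :=
      EReal.coe_lt_coe_iff.2 (by linarith)
    filter_upwards [hf, eventually_nhdsWithin_iff.1
      (Filter.eventually_lt_of_limsup_lt (hlim.trans_lt hlt))] with x hx hx'
    rcases eq_or_ne x xb with rfl | hne
    · simp [hft]
    · convert EReal.coe_le_of_max_sub_mul_inv_lt (dist_pos.2 hne) hx (hx' hne) using 2
      ring
end
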